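/- arXiv:0903.1099 — 4 statements merged into one kernel-verified Lean document; each statement's English description precedes it below -/
import Mathlib

section
/- Let R be an almost perfect domain (an integral domain such that R/I is a perfect ring for every nonzero ideal I) with field of fractions Q ≠ R. An R-module M is injective if and only if M is divisible and the injective dimension of M is at most 1. -/
universe u

/-- `f : P →ₗ[R] M` is a projective cover of `M`. -/
def IsProjectiveCover (R : Type u) [CommRing R] {P M : Type u}
    [AddCommGroup P] [Module R P] [AddCommGroup M] [Module R M] (f : P →ₗ[R] M) : Prop :=
  Module.Projective R P ∧ Function.Surjective f ∧
    ∀ N : Submodule R P, N ⊔ LinearMap.ker f = ⊤ → N = ⊤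

/-- A commutative ring is perfect iff every module has a projective cover. -/
def IsPerfectRing (R : Type u) [CommRing R] : Prop :=
  ∀ (M : Type u) (_ : AddCommGroup M) (_ : Module R M),
    ∃ (P : Type u) (_ : AddCommGroup P) (_ : Module R P) (f : P →ₗ[R] M),
      IsProjectiveCover R f

/-- An almost perfect domain: an integral domain such that every proper quotient is perfect. -/
def IsAPD (R : Type u) [CommRing R] [IsDomain R] : Prop :=
  ∀ I : Ideal R, I ≠ ⊥ → IsPerfectRing (R ⧸ I)
open CategoryTheory Limits

/-- `InjDimLE R n M` : the injective dimension of `M` is at most `n`. -/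
def InjDimLE (R : Type u) [CommRing R] : ℕ → ModuleCat.{u} R → Prop
  | 0, M => Injective M
  | n + 1, M => ∃ (E : ModuleCat.{u} R) (f : M ⟶ E),
      Mono f ∧ Injective E ∧ InjDimLE R n (cokernel f)

/-- `ProjDimLE R n M` : the projective dimension of `M` is at most `n`. -/
def ProjDimLE (R : Type u) [CommRing R] : ℕ → ModuleCat.{u} R → Prop
  | 0, M => Projective M
  | n + 1, M => ∃ (P : ModuleCat.{u} R) (f : P ⟶ M),
      Epi f ∧ Projective P ∧ ProjDimLE R n (kernel f)

/-- `FlatDimLE R n M` : the flat (weak) dimension of `M` is at most `n`. -/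
def FlatDimLE (R : Type u) [CommRing R] : ℕ → ModuleCat.{u} R → Prop
  | 0, M => Module.Flat R M
  | n + 1, M => ∃ (P : ModuleCat.{u} R) (f : P ⟶ M),
      Epi f ∧ Module.Flat R P ∧ FlatDimLE R n (kernel f)

/-- An `R`-module is divisible if `rM = M` for every nonzero `r : R`. -/
def IsDivisibleModule (R : Type u) [CommRing R] (M : Type u) [AddCommGroup M] [Module R M] :
    Prop :=
  ∀ r : R, r ≠ 0 → ∀ m : M, ∃ x : M, r • x = m

/-- A projective module `Q` with `J Q = Q`, for `J` inside the Jacobson radical, vanishes. -/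
theorem apd_projective_eq_zero {S : Type u} [CommRing S] {Q : Type u} [AddCommGroup Q] [Module S Q]
    (hQ : Module.Projective S Q) (J : Ideal S) (hJ : J ≤ Ideal.jacobson ⊥)
    (h : J • (⊤ : Submodule S Q) = ⊤) (x : Q) : x = 0 := by
  obtain ⟨s, hs⟩ := Module.projective_def.1 hQ
  have hmem : ∀ q q' : Q, s q q' ∈ J := by
    intro q q'
    have hq : q ∈ J • (⊤ : Submodule S Q) := by rw [h]; trivial
    have := Submodule.mem_map_of_mem (f := (Finsupp.lapply q').comp s) hq
    rw [Submodule.map_smul''] at this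
    have h2 := Submodule.smul_mono le_rfl
      (le_top : Submodule.map ((Finsupp.lapply q').comp s) ⊤ ≤ ⊤) this
    simpa using h2
  set C : Ideal S := Ideal.span (s x '' ((s x).support : Set Q)) with hC
  have hmemC : ∀ q, s x q ∈ C := by
    intro q
    by_cases h0 : s x q = 0
    · rw [h0]; exact C.zero_mem
    · exact Ideal.subset_span ⟨q, by simpa using h0, rfl⟩
  have hfg : C.FG := Submodule.fg_span (((s x).support.finite_toSet).image _)
  have hle : C ≤ J • C := by
    rw [hC, Ideal.span_le, ← hC]
    rintro _ ⟨q', -, rfl⟩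
    have e1 : s x = (s x).sum fun q c => c • s q := by
      conv_lhs => rw [← hs x]
      rw [Finsupp.linearCombination_apply, map_finsuppSum]
      simp
    rw [e1, Finsupp.sum, Finsupp.finsetSum_apply]
    refine Submodule.sum_mem _ fun q _ => ?_
    have e2 : (s x q • s q) q' = s q q' * s x q := mul_comm _ _
    rw [e2]
    exact Ideal.mul_mem_mul (hmem q q') (hmemC q)
  have hb := Submodule.eq_bot_of_le_smul_of_le_jacobson_bot J C hfg hle hJ
  have hsx : s x = 0 := by
    ext q
    have := hmemC q
    rw [hb] at this
    simpa using this
  rw [← hs x, hsx, map_zero]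

/-- Over a perfect ring, a module `M` with `J M = M`, `J` in the radical, vanishes. -/
theorem apd_nakayama {S : Type u} [CommRing S] (hS : IsPerfectRing S) {M : Type u}
    [AddCommGroup M] [Module S M] (J : Ideal S) (hJ : J ≤ Ideal.jacobson ⊥)
    (h : J • (⊤ : Submodule S M) = ⊤) (x : M) : x = 0 := by
  obtain ⟨P, _, _, f, hP, hf, hsup⟩ := hS M inferInstance inferInstance
  have h1 : J • (⊤ : Submodule S P) = ⊤ := by
    apply hsup
    rw [eq_top_iff]
    intro q _
    have hq : f q ∈ Submodule.map f (J • (⊤ : Submodule S P)) := by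
      rw [Submodule.map_smul'', Submodule.map_top, LinearMap.range_eq_top.2 hf, h]; trivial
    obtain ⟨q', hq', e⟩ := hq
    rw [← add_sub_cancel q' q]
    exact Submodule.add_mem_sup hq' (by simp [e])
  obtain ⟨q, rfl⟩ := hf x
  rw [apd_projective_eq_zero hP J hJ h1 q, map_zero]

/-- T-nilpotency of the radical. -/
theorem apd_tnilpotent {S : Type u} [CommRing S] (hS : IsPerfectRing S) (b : ℕ → S)
    (hb : ∀ k, b k ∈ Ideal.jacobson (⊥ : Ideal S)) :
    ∃ N, ∏ i ∈ Finset.range N, b i = 0 := by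
  by_contra! hne
  let G := Filter.Germ (Filter.atTop : Filter ℕ) S
  let y : ℕ → G := fun k => ((fun N => ∏ i ∈ Finset.Ico k N, b i : ℕ → S) : G)
  have hy : ∀ k, y k = b k • y (k + 1) := by
    intro k
    refine Filter.Germ.coe_eq.2 ?_
    filter_upwards [Filter.eventually_gt_atTop k] with N hN
    simp [Finset.prod_eq_prod_Ico_succ_bot hN]
  let M : Submodule S G := Submodule.span S (Set.range y)
  have hyM : ∀ k, y k ∈ M := fun k => Submodule.subset_span ⟨k, rfl⟩
  have hJM : Ideal.jacobson (⊥ : Ideal S) • (⊤ : Submodule S M) = ⊤ := by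
    apply Submodule.map_injective_of_injective M.injective_subtype
    rw [Submodule.map_smul'', Submodule.map_top, Submodule.range_subtype]
    apply le_antisymm Submodule.smul_le_right
    refine Submodule.span_le.2 ?_
    rintro _ ⟨k, rfl⟩
    rw [hy k]
    exact Submodule.smul_mem_smul (hb k) (hyM _)
  have h0 := apd_nakayama hS _ le_rfl hJM ⟨y 0, hyM 0⟩
  have h1 : y 0 = 0 := congrArg M.subtype h0
  have h2 : (fun N => ∏ i ∈ Finset.Ico 0 N, b i) =ᶠ[Filter.atTop] (fun _ => (0 : S)) :=
    Filter.Germ.coe_eq.1 h1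
  obtain ⟨N, hN⟩ := h2.exists
  exact hne N (by rw [Finset.range_eq_Ico]; exact hN)

/-- Over a perfect ring every maximal ideal annihilates a nonzero element. -/
theorem apd_socle {S : Type u} [CommRing S] (hS : IsPerfectRing S) (n : Ideal S)
    (hn : n.IsMaximal) : ∃ s : S, s ≠ 0 ∧ ∀ a ∈ n, a * s = 0 := by
  obtain ⟨P, _, _, f, hP, hf, hsup⟩ := hS (S ⧸ n) inferInstance inferInstance
  obtain ⟨p, hp⟩ := hf 1
  have hfs : ∀ a : S, f (a • p) = Ideal.Quotient.mk n a := by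
    intro a
    rw [map_smul, hp, ← mul_one (Ideal.Quotient.mk n a)]; rfl
  have hgen : LinearMap.range (LinearMap.toSpanSingleton S P p) = ⊤ := by
    apply hsup
    rw [eq_top_iff]
    intro q _
    obtain ⟨a, ha⟩ := Ideal.Quotient.mk_surjective (f q)
    rw [← add_sub_cancel (a • p) q]
    exact Submodule.add_mem_sup ⟨a, by simp⟩ (by rw [LinearMap.mem_ker, map_sub, hfs, ha, sub_self])
  obtain ⟨σ, hσ⟩ := Module.projective_lifting_property (LinearMap.toSpanSingleton S P p)
    LinearMap.id (LinearMap.range_eq_top.1 hgen)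
  set e : S := σ p with he
  have hep : e • p = p := by simpa using LinearMap.congr_fun hσ p
  have hee : e * e = e := by
    conv_rhs => rw [he, ← hep]
    rw [map_smul, smul_eq_mul]
  have hen : e ∉ n := by
    intro h
    have h1 := hfs e
    rw [hep, hp, Ideal.Quotient.eq_zero_iff_mem.2 h] at h1
    exact hn.ne_top ((Ideal.eq_top_iff_one n).2 (Ideal.Quotient.eq_zero_iff_mem.1 (by rw [map_one]; exact h1)))
  have hother : ∀ n' : Ideal S, n'.IsMaximal → n' ≠ n → e ∈ n' := by
    intro n' hn' hne
    have htop : n' ⊔ n = ⊤ := hn'.coprime_of_ne hn hne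
    obtain ⟨a, ha, b, hb, hab⟩ := Submodule.mem_sup.1 ((Ideal.eq_top_iff_one _).1 htop)
    have h1 : Submodule.map (LinearMap.toSpanSingleton S P p) n' = ⊤ := by
      apply hsup
      rw [eq_top_iff]
      intro q _
      obtain ⟨c, rfl⟩ := LinearMap.range_eq_top.1 hgen q
      have : LinearMap.toSpanSingleton S P p c = (c * a) • p + (c * b) • p := by
        rw [← add_smul, ← mul_add, hab, mul_one]; simp
      rw [this]
      refine Submodule.add_mem_sup ⟨c * a, n'.mul_mem_left c ha, by simp⟩ ?_
      rw [LinearMap.mem_ker, hfs]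
      exact Ideal.Quotient.eq_zero_iff_mem.2 (n.mul_mem_left c hb)
    have h2 : p ∈ Submodule.map (LinearMap.toSpanSingleton S P p) n' := by rw [h1]; trivial
    obtain ⟨c, hc, hcp⟩ := h2
    have hcp' : c • p = p := by simpa using hcp
    rw [he, ← hcp', map_smul, smul_eq_mul]
    exact n'.mul_mem_right _ hc
  have hjac : ∀ a ∈ n, a * e ∈ Ideal.jacobson (⊥ : Ideal S) := by
    intro a ha
    rw [Ideal.jacobson, Ideal.mem_sInf]
    rintro n' ⟨-, hn'⟩
    by_cases h : n' = n
    · subst h; exact n'.mul_mem_right _ ha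
    · exact n'.mul_mem_left _ (hother n' hn' h)
  by_contra! hcon
  have he0 : e ≠ 0 := fun h => hen (h ▸ n.zero_mem)
  let T := {s : S // s ≠ 0 ∧ e * s = s}
  choose a han has using fun t : T => hcon t.1 t.2.1
  let st : ℕ → T := fun k => Nat.rec ⟨e, he0, hee⟩
    (fun _ t => ⟨a t * t.1, has t, by rw [mul_left_comm, t.2.2]⟩) k
  obtain ⟨N, hN⟩ := apd_tnilpotent hS (fun k => a (st k) * e) (fun k => hjac _ (han _))
  have key : ∀ k, (∏ i ∈ Finset.range k, (a (st i) * e)) * e = (st k).1 := by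
    intro k
    induction k with
    | zero => simp [st]
    | succ k ih =>
      have h1 : (st (k + 1)).1 = a (st k) * (st k).1 := rfl
      rw [Finset.prod_range_succ, h1, ← ih]
      linear_combination (∏ i ∈ Finset.range k, (a (st i) * e)) * a (st k) * hee
  have := key N
  rw [hN, zero_mul] at this
  exact (st N).2.1 this.symm

/-- Over an APD: for `J` nonzero inside a maximal `m`, some `s ∉ J` has `m s ⊆ J`. -/
theorem apd_socle_quot {R : Type u} [CommRing R] [IsDomain R] (hR : IsAPD R) (J m : Ideal R)
    (hJ : J ≠ ⊥) (hm : m.IsMaximal) (hJm : J ≤ m) : ∃ s : R, s ∉ J ∧ ∀ a ∈ m, a * s ∈ J := by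
  have hmax : (m.map (Ideal.Quotient.mk J)).IsMaximal := by
    refine (Ideal.map_eq_top_or_isMaximal_of_surjective _ Ideal.Quotient.mk_surjective
      hm).resolve_left fun h => hm.ne_top ?_
    have h2 := Ideal.comap_map_of_surjective (Ideal.Quotient.mk J) Ideal.Quotient.mk_surjective m
    rw [h, Ideal.comap_top, ← RingHom.ker_eq_comap_bot, Ideal.mk_ker, sup_eq_left.2 hJm] at h2
    exact h2.symm
  obtain ⟨s, hs0, hs⟩ := apd_socle (hR J hJ) _ hmax
  obtain ⟨s, rfl⟩ := Ideal.Quotient.mk_surjective s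
  refine ⟨s, fun h => hs0 (Ideal.Quotient.eq_zero_iff_mem.2 h), fun a ha => ?_⟩
  have := hs _ (Ideal.mem_map_of_mem _ ha)
  rw [← map_mul] at this
  exact Ideal.Quotient.eq_zero_iff_mem.1 this

/-- Extending maps from maximal ideals. -/
theorem apd_extend_maximal {R : Type u} [CommRing R] [IsDomain R] (hR : IsAPD R)
    (hQ : ¬ IsField R) {M E : Type u} [AddCommGroup M] [Module R M] [AddCommGroup E] [Module R E]
    (hM : IsDivisibleModule R M) (i : M →ₗ[R] E) (hi : Function.Injective i)
    (hE : Module.Injective R E) (hC : Module.Injective R (E ⧸ LinearMap.range i))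
    (m : Ideal R) (hm : m.IsMaximal) (g : m →ₗ[R] M) :
    ∃ w : M, ∀ a : m, (a : R) • w = g a := by
  have hm0 : m ≠ ⊥ := Ring.ne_bot_of_isMaximal_of_not_isField hm hQ
  obtain ⟨r, hrm, hr0⟩ := Submodule.exists_mem_ne_zero_of_ne_bot hm0
  obtain ⟨s, hs, hms⟩ := apd_socle_quot hR (Ideal.span {r}) m (by simpa using hr0) hm
    (by simpa [Ideal.span_le] using hrm)
  obtain ⟨G, hG⟩ := hE.out m.subtype m.injective_subtype (i ∘ₗ g)
  set y : E := G 1 with hy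
  have hGy : ∀ a : m, (a : R) • y = i (g a) := by
    intro a
    have := hG a
    rw [hy, ← map_smul, smul_eq_mul, mul_one]
    exact this
  let π := (LinearMap.range i).mkQ
  -- map `R/m → R/r`
  let α : (R ⧸ m) →ₗ[R] (R ⧸ Ideal.span {r}) :=
    Submodule.liftQ m (LinearMap.toSpanSingleton R (R ⧸ Ideal.span {r}) (Submodule.Quotient.mk s))
      (by
        intro a ha
        rw [LinearMap.mem_ker, LinearMap.toSpanSingleton_apply, ← Submodule.Quotient.mk_smul,
          Submodule.Quotient.mk_eq_zero]
        exact hms a ha)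
  have hα : Function.Injective α := by
    rw [← LinearMap.ker_eq_bot]
    refine Submodule.ker_liftQ_eq_bot _ _ _ ?_
    have hle : m ≤ LinearMap.ker
        (LinearMap.toSpanSingleton R (R ⧸ Ideal.span {r}) (Submodule.Quotient.mk s)) := by
      intro a ha
      rw [LinearMap.mem_ker, LinearMap.toSpanSingleton_apply, ← Submodule.Quotient.mk_smul,
          Submodule.Quotient.mk_eq_zero]
      exact hms a ha
    refine (hm.eq_of_le ?_ hle).ge
    intro h
    have h1 := (Ideal.eq_top_iff_one _).1 h
    rw [LinearMap.mem_ker, LinearMap.toSpanSingleton_apply, one_smul,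
      Submodule.Quotient.mk_eq_zero] at h1
    exact hs h1
  let β : (R ⧸ m) →ₗ[R] (E ⧸ LinearMap.range i) :=
    Submodule.liftQ m (LinearMap.toSpanSingleton R _ (π y)) (by
      intro a ha
      rw [LinearMap.mem_ker, LinearMap.toSpanSingleton_apply, ← map_smul, hGy ⟨a, ha⟩]
      exact (Submodule.Quotient.mk_eq_zero _).2 ⟨_, rfl⟩)
  obtain ⟨φ, hφ⟩ := hC.out α hα β
  obtain ⟨z, hz⟩ := Submodule.mkQ_surjective _ (φ (Submodule.Quotient.mk 1))
  have hsz : s • π z = π y := by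
    have h1 := hφ (Submodule.Quotient.mk 1)
    have h2 : β (Submodule.Quotient.mk 1) = π y := one_smul R (π y)
    have h3 : α (Submodule.Quotient.mk 1) = s • Submodule.Quotient.mk 1 := by
      have h4 : α (Submodule.Quotient.mk 1) = (1 : R) • Submodule.Quotient.mk s := rfl
      rw [h4, one_smul, ← Submodule.Quotient.mk_smul, smul_eq_mul, mul_one]
    rw [h2, h3, map_smul, ← hz] at h1
    exact h1
  have hrz : π (r • z) = 0 := by
    rw [map_smul]
    change r • (LinearMap.range i).mkQ z = 0
    rw [hz, ← map_smul, ← Submodule.Quotient.mk_smul,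
      (Submodule.Quotient.mk_eq_zero _).2, map_zero]
    simp [Ideal.mem_span_singleton_self r]
  obtain ⟨x0, hx0⟩ := (Submodule.Quotient.mk_eq_zero _).1 hrz
  obtain ⟨x, rfl⟩ := hM r hr0 x0
  have hz' : r • (z - i x) = 0 := by rw [smul_sub, ← hx0, map_smul, sub_self]
  have hw : s • (z - i x) - y ∈ LinearMap.range i := by
    refine (Submodule.Quotient.mk_eq_zero _).1 ?_
    change π _ = 0
    rw [map_sub, map_smul, map_sub, smul_sub, hsz]
    have : π (i x) = 0 := (Submodule.Quotient.mk_eq_zero _).2 ⟨_, rfl⟩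
    simp [this]
  obtain ⟨w, hw⟩ := hw
  refine ⟨-w, fun a => hi ?_⟩
  obtain ⟨c, hc⟩ := Ideal.mem_span_singleton'.1 (hms a a.2)
  have h5 : ((a : R) * s) • (z - i x) = 0 := by rw [← hc, mul_smul, hz', smul_zero]
  rw [map_smul, map_neg, hw, smul_neg, smul_sub, ← mul_smul, h5, hGy, zero_sub, neg_neg]

/-- Semiartinian form of Baer's criterion. -/
theorem apd_baer {R : Type u} [CommRing R] [IsDomain R] (hR : IsAPD R)
    {M : Type u} [AddCommGroup M] [Module R M]
    (h : ∀ (m : Ideal R), m.IsMaximal → ∀ g : m →ₗ[R] M, ∃ w : M, ∀ a : m, (a : R) • w = g a) :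
    Module.Baer R M := by
  intro I g
  by_cases hI : I = ⊥
  · subst hI
    refine ⟨0, fun x hx => ?_⟩
    have : (⟨x, hx⟩ : (⊥ : Ideal R)) = 0 := Subtype.ext (by simpa using hx)
    rw [this, map_zero, LinearMap.zero_apply]
  have : Fact (Function.Injective I.subtype) := ⟨I.injective_subtype⟩
  obtain ⟨X, hX⟩ : ∃ X : Module.Baer.ExtensionOf I.subtype g, ∀ Y, X ≤ Y → Y = X :=
    ⟨Module.Baer.extensionOfMax I.subtype g, Module.Baer.extensionOfMax_is_max I.subtype g⟩
  have hIX : I ≤ X.domain := by simpa using X.le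
  have htop : X.domain = ⊤ := by
    by_contra hne
    obtain ⟨m, hm, hle⟩ := Ideal.exists_le_maximal X.domain hne
    obtain ⟨s, hs, hms⟩ := apd_socle_quot hR X.domain m
      (fun h0 => hI (le_bot_iff.1 (h0 ▸ hIX))) hm hle
    let g' : m →ₗ[R] M := X.toFun ∘ₗ
      LinearMap.codRestrict X.domain ((LinearMap.toSpanSingleton R R s) ∘ₗ m.subtype)
        (fun a => hms a a.2)
    obtain ⟨w, hw⟩ := h m hm g'
    have hcol : ∀ c : R, c * s ∈ X.domain → c ∈ m := by
      intro c hc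
      by_contra hcm
      obtain ⟨d, a, ha, hda⟩ := hm.exists_inv hcm
      apply hs
      have : s = d * (c * s) + a * s := by linear_combination (-s) * hda
      rw [this]
      exact X.domain.add_mem (X.domain.smul_mem d hc) (hms a ha)
    have hw' : ∀ (c : R) (hc : c * s ∈ X.domain), c • w = X.toLinearPMap ⟨c * s, hc⟩ :=
      fun c hc => hw ⟨c, hcol c hc⟩
    have H : ∀ c : R, c • s = 0 → c • w = 0 := by
      intro c hc
      have hc' : c * s = 0 := hc
      rw [hw' c (by rw [hc']; exact X.domain.zero_mem)]
      have : (⟨c * s, by rw [hc']; exact X.domain.zero_mem⟩ : X.domain) = 0 := Subtype.ext hc'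
      rw [this, LinearPMap.map_zero]
    let p : R →ₗ.[R] M := LinearPMap.mkSpanSingleton' (σ := RingHom.id R) s w H
    have hcompat : ∀ (u : X.domain) (v : p.domain), (u : R) = v → X.toLinearPMap u = p v := by
      rintro ⟨u, hu⟩ ⟨v, hv⟩ huv
      obtain ⟨c, rfl⟩ := Submodule.mem_span_singleton.1 hv
      obtain rfl : u = c * s := huv
      rw [← hw' c hu]
      exact (LinearPMap.mkSpanSingleton'_apply (σ := RingHom.id R) s w H c hv).symm
    have hlesup := LinearPMap.left_le_sup X.toLinearPMap p hcompat
    let Y : Module.Baer.ExtensionOf I.subtype g :=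
      { X.toLinearPMap.sup p hcompat with
        le := X.le.trans hlesup.1
        is_extension := fun a => (X.is_extension a).trans (hlesup.2 rfl) }
    have hY : Y = X := hX Y hlesup
    apply hs
    rw [← hY]
    exact (LinearPMap.right_le_sup X.toLinearPMap p hcompat).1
      (Submodule.mem_span_singleton_self s)
  refine ⟨X.toFun ∘ₗ LinearMap.codRestrict X.domain LinearMap.id (fun x => by rw [htop]; trivial),
    fun x hx => ?_⟩
  exact (X.is_extension ⟨x, hx⟩).symm

/-- Over an almost perfect domain that is not a field, a module is injective iff it is
divisible and of injective dimension at most `1`. -/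
theorem injective_iff_divisible_and_injDimLE_one (R : Type u) [CommRing R] [IsDomain R]
    (hR : IsAPD R) (hQ : ¬ IsField R) (M : Type u) [AddCommGroup M] [Module R M] :
    Module.Injective R M ↔
      IsDivisibleModule R M ∧ InjDimLE R 1 (ModuleCat.of R M) := by
  constructor
  · intro hM
    constructor
    · intro r hr m
      obtain ⟨h, hh⟩ := hM.out (LinearMap.toSpanSingleton R R r)
        (fun a b hab => mul_right_cancel₀ hr (by simpa using hab))
        (LinearMap.toSpanSingleton R M m)
      refine ⟨h 1, ?_⟩
      have := hh 1
      rw [← map_smul]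
      simpa using this
    · refine ⟨ModuleCat.of R M, 𝟙 _, inferInstance,
        (Module.injective_iff_injective_object R M).1 hM, ?_⟩
      exact Injective.of_iso (cokernel.ofEpi (𝟙 (ModuleCat.of R M))).symm inferInstance
  · rintro ⟨hdiv, E, f, hf, hE, hC⟩
    have hC' : Injective (cokernel f) := hC
    have hC2 : Injective (ModuleCat.of R (E ⧸ LinearMap.range f.hom)) :=
      Injective.of_iso (ModuleCat.cokernelIsoRangeQuotient f) hC'
    refine Module.Baer.injective (apd_baer hR fun m hm g => ?_)
    exact apd_extend_maximal hR hQ hdiv f.hom ((ModuleCat.mono_iff_injective f).1 hf)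
      ((Module.injective_iff_injective_object R E).2 hE)
      ((Module.injective_iff_injective_object R _).2 hC2) m hm g
end

section
/- Let R be an almost perfect domain with Q ≠ R. If an R-module M has finite injective dimension, then its injective dimension is at most 1. -/
universe u

open CategoryTheory Limits

section Helpers

/-- Transition endomorphism of the free module used for Bass's module. -/
noncomputable def bassPhi {S : Type u} [CommRing S] (a : ℕ → S) (M : ℕ) :
    (ℕ →₀ S) →ₗ[S] (ℕ →₀ S) :=
  Finsupp.linearCombination S
    (fun j => Finsupp.single (max j M) (∏ i ∈ Finset.Ico j (max j M), a i))

theorem bassPhi_single {S : Type u} [CommRing S] (a : ℕ → S) (M j : ℕ) (s : S) :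
    bassPhi a M (Finsupp.single j s) =
      Finsupp.single (max j M) (s * ∏ i ∈ Finset.Ico j (max j M), a i) := by
  simp [bassPhi, Finsupp.linearCombination_single]

theorem bassPhi_comp {S : Type u} [CommRing S] (a : ℕ → S) {M N : ℕ} (h : M ≤ N)
    (x : ℕ →₀ S) : bassPhi a N (bassPhi a M x) = bassPhi a N x := by
  induction x using Finsupp.induction_linear with
  | zero => simp
  | add f g hf hg => simp [hf, hg]
  | single j s =>
    rw [bassPhi_single, bassPhi_single, bassPhi_single]
    have h1 : max (max j M) N = max j N := by omega
    rw [h1, mul_assoc, Finset.prod_Ico_consecutive] <;> omega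

/-- The relations of Bass's module. -/
noncomputable def bassRel {S : Type u} [CommRing S] (a : ℕ → S) : Submodule S (ℕ →₀ S) :=
  ⨆ M, LinearMap.ker (bassPhi a M)

theorem mem_bassRel {S : Type u} [CommRing S] (a : ℕ → S) (x : ℕ →₀ S) :
    x ∈ bassRel a ↔ ∃ M, bassPhi a M x = 0 := by
  have hd : Directed (· ≤ ·) (fun M => LinearMap.ker (bassPhi a M)) := by
    apply Monotone.directed_le
    intro M N h y hy
    rw [LinearMap.mem_ker] at hy ⊢
    rw [← bassPhi_comp a h, hy, map_zero]
  rw [bassRel, Submodule.mem_iSup_of_directed _ hd]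
  simp

theorem mk_bassPhi {S : Type u} [CommRing S] (a : ℕ → S) (M : ℕ) (x : ℕ →₀ S) :
    (bassRel a).mkQ (bassPhi a M x) = (bassRel a).mkQ x := by
  rw [← sub_eq_zero, ← map_sub, Submodule.mkQ_apply, Submodule.Quotient.mk_eq_zero, mem_bassRel]
  exact ⟨M, by rw [map_sub, bassPhi_comp a le_rfl, sub_self]⟩

theorem surj_of_cover {S : Type u} [CommRing S] {P L X : Type u}
    [AddCommGroup P] [Module S P] [AddCommGroup L] [Module S L] [AddCommGroup X] [Module S X]
    {f : P →ₗ[S] L} (hf : IsProjectiveCover S f) (g : X →ₗ[S] P)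
    (h : Function.Surjective (f ∘ₗ g)) : Function.Surjective g := by
  rw [← LinearMap.range_eq_top]
  apply hf.2.2
  rw [eq_top_iff]
  intro p _
  obtain ⟨x, hx⟩ := h (f p)
  have : p = g x + (p - g x) := by abel
  rw [this]
  refine Submodule.add_mem_sup ⟨x, rfl⟩ ?_
  rw [LinearMap.mem_ker, map_sub, sub_eq_zero]
  exact hx.symm

theorem bass_split {S : Type u} [CommRing S] (hS : IsPerfectRing S) (a : ℕ → S) :
    ∃ σ : ((ℕ →₀ S) ⧸ bassRel a) →ₗ[S] (ℕ →₀ S), ∀ y, (bassRel a).mkQ (σ y) = y := by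
  obtain ⟨P, _, _, f, hf⟩ := hS ((ℕ →₀ S) ⧸ bassRel a) inferInstance inferInstance
  have hP := hf.1
  obtain ⟨α, hα⟩ := Module.projective_lifting_property f (bassRel a).mkQ hf.2.1
  have hαs : Function.Surjective α := by
    have hc := hf
    rw [← LinearMap.range_eq_top]
    apply hf.2.2
    rw [eq_top_iff]
    intro p _
    obtain ⟨x, hx⟩ := (bassRel a).mkQ_surjective (f p)
    have : p = α x + (p - α x) := by abel
    rw [this]
    refine Submodule.add_mem_sup ⟨x, rfl⟩ ?_
    rw [LinearMap.mem_ker, map_sub, sub_eq_zero, ← hx, ← hα]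
    rfl
  obtain ⟨β, hβ⟩ := Module.projective_lifting_property α LinearMap.id hαs
  have hβ' : ∀ p, α (β p) = p := fun p => LinearMap.congr_fun hβ p
  have hα' : ∀ x, f (α x) = (bassRel a).mkQ x := fun x => LinearMap.congr_fun hα x
  have hinj : Function.Injective f := by
    rw [injective_iff_map_eq_zero]
    intro x hx
    have h0 : β x ∈ bassRel a := by
      rw [← Submodule.Quotient.mk_eq_zero, ← Submodule.mkQ_apply, ← hα', hβ', hx]
    obtain ⟨M, hM⟩ := (mem_bassRel a _).1 h0
    let ψ : P →ₗ[S] P := α ∘ₗ bassPhi a M ∘ₗ β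
    have hfψ : ∀ p, f (ψ p) = f p := by
      intro p
      change f (α (bassPhi a M (β p))) = f p
      rw [hα', mk_bassPhi, ← hα', hβ']
    have hψs : Function.Surjective ψ := by
      apply surj_of_cover hf
      intro y
      obtain ⟨p, rfl⟩ := hf.2.1 y
      exact ⟨p, hfψ p⟩
    obtain ⟨τ, hτ⟩ := Module.projective_lifting_property ψ LinearMap.id hψs
    have hτ' : ∀ p, ψ (τ p) = p := fun p => LinearMap.congr_fun hτ p
    have hτs : Function.Surjective τ := by
      apply surj_of_cover hf
      intro y
      obtain ⟨p, rfl⟩ := hf.2.1 y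
      refine ⟨p, ?_⟩
      change f (τ p) = f p
      rw [← hfψ, hτ']
    obtain ⟨y, rfl⟩ := hτs x
    have h1 : ψ (τ y) = 0 := by
      change α (bassPhi a M (β (τ y))) = 0
      rw [hM, map_zero]
    rw [hτ'] at h1
    rw [h1, map_zero]
  let e := LinearEquiv.ofBijective f ⟨hinj, hf.2.1⟩
  refine ⟨β ∘ₗ e.symm.toLinearMap, fun y => ?_⟩
  obtain ⟨p, rfl⟩ := e.surjective y
  change (bassRel a).mkQ (β (e.symm (e p))) = f p
  rw [e.symm_apply_apply, ← hα', hβ']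

theorem perfect_dcc_aux {S : Type u} [CommRing S] (hS : IsPerfectRing S) (a : ℕ → S) :
    ∃ M, ∀ n, ∃ t, ∏ i ∈ Finset.range M, a i = (∏ i ∈ Finset.range n, a i) * t := by
  obtain ⟨σ, hσ⟩ := bass_split hS a
  set π := (bassRel a).mkQ with hπ
  have h0 : σ (π (Finsupp.single 0 1)) - Finsupp.single 0 1 ∈ bassRel a := by
    rw [← Submodule.Quotient.mk_eq_zero, ← Submodule.mkQ_apply, map_sub, hσ, sub_self]
  obtain ⟨M, hM⟩ := (mem_bassRel a _).1 h0
  refine ⟨M, fun n => ?_⟩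
  rw [map_sub, sub_eq_zero] at hM
  have hn : π (Finsupp.single 0 1) =
      (∏ i ∈ Finset.range n, a i) • π (Finsupp.single n 1) := by
    rw [hπ, ← mk_bassPhi a n, ← map_smul, bassPhi_single]
    simp
  rw [hn, map_smul, map_smul, bassPhi_single] at hM
  have := DFunLike.congr_fun hM M
  refine ⟨bassPhi a M (σ (π (Finsupp.single n 1))) M, ?_⟩
  simpa using this.symm

theorem perfect_min {S : Type u} [CommRing S] (hS : IsPerfectRing S) (A : Set S)
    (hA : A.Nonempty) : ∃ x ∈ A, ∀ y, x * y ∈ A → ∃ t, x = x * y * t := by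
  by_contra! hcon
  obtain ⟨x0, hx0⟩ := hA
  choose! y hy hy' using hcon
  let x : ℕ → S := fun n => Nat.rec x0 (fun _ z => z * y z) n
  have hx : ∀ n, x (n + 1) = x n * y (x n) := fun n => rfl
  have hxA : ∀ n, x n ∈ A := by
    intro n
    induction n with
    | zero => exact hx0
    | succ n ih => rw [hx]; exact hy _ ih
  let a : ℕ → S := fun n => Nat.casesOn n x0 (fun k => y (x k))
  have ha : ∀ n, ∏ i ∈ Finset.range (n + 1), a i = x n := by
    intro n
    induction n with
    | zero => simp [a, x]
    | succ n ih => rw [Finset.prod_range_succ, ih, hx]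
  obtain ⟨M, hM⟩ := perfect_dcc_aux hS a
  obtain ⟨t, ht⟩ := hM (M + 2)
  have h1 : x M = x (M + 1) * (t * a M) := by
    rw [← ha M, Finset.prod_range_succ, ht, ha (M + 1)]
    ring
  rw [hx] at h1
  exact hy' _ (hxA M) _ h1

/-- A nonzero perfect ring has a simple ideal. -/
theorem perfect_simple {S : Type u} [CommRing S] [Nontrivial S] (hS : IsPerfectRing S) :
    ∃ x : S, x ≠ 0 ∧ ∀ s, s * x ≠ 0 → ∃ t, t * (s * x) = x := by
  obtain ⟨x, hx, h⟩ := perfect_min hS {x | x ≠ 0} ⟨1, one_ne_zero⟩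
  refine ⟨x, hx, fun s hs => ?_⟩
  obtain ⟨t, ht⟩ := h s (by rw [mul_comm]; exact hs)
  exact ⟨t, by rw [mul_comm s, mul_comm t, ← ht]⟩

/-- Every maximal ideal of a perfect ring is an annihilator. -/
theorem perfect_assoc {S : Type u} [CommRing S] (hS : IsPerfectRing S) (m : Ideal S)
    [hm : m.IsMaximal] : ∃ x : S, ∀ s, s * x = 0 ↔ s ∈ m := by
  obtain ⟨e, he, hmin⟩ := perfect_min hS {x | x ∉ m}
    ⟨1, fun h => hm.ne_top ((Ideal.eq_top_iff_one m).2 h)⟩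
  have he0 : e ≠ 0 := fun h => he (h ▸ m.zero_mem)
  obtain ⟨y, ⟨hy0, w, hw⟩, hymin⟩ := perfect_min hS {y | y ≠ 0 ∧ ∃ w, y = e * w}
    ⟨e, he0, 1, (mul_one e).symm⟩
  have h1 : ∀ s, s * y = 0 → s ∈ m := by
    intro s hs
    by_contra hsm
    obtain ⟨t, ht⟩ := hmin s (fun h => (hm.isPrime.mem_or_mem h).elim he hsm)
    apply hy0
    calc y = e * w := hw
      _ = e * s * t * w := by rw [← ht]
      _ = t * (s * (e * w)) := by ring
      _ = 0 := by rw [← hw, hs, mul_zero]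
  refine ⟨y, fun s => ⟨h1 s, fun hs => ?_⟩⟩
  by_contra hsy
  obtain ⟨t, ht⟩ := hymin s ⟨by rwa [mul_comm], w * s, by rw [hw, mul_assoc]⟩
  have h2 : (1 - s * t) * y = 0 := by
    rw [sub_mul, one_mul, sub_eq_zero]
    conv_lhs => rw [ht]
    ring
  have h3 := m.add_mem (h1 _ h2) (m.mul_mem_right t hs)
  rw [sub_add_cancel] at h3
  exact hm.ne_top ((Ideal.eq_top_iff_one m).2 h3)

theorem apd_simple {R : Type u} [CommRing R] [IsDomain R] (hR : IsAPD R) (J : Ideal R)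
    (h0 : J ≠ ⊥) (h1 : J ≠ ⊤) :
    ∃ c : R, c ∉ J ∧ ∃ m : Ideal R, m.IsMaximal ∧ ∀ s, s ∈ m ↔ s * c ∈ J := by
  have : Nontrivial (R ⧸ J) := Ideal.Quotient.nontrivial_iff.2 h1
  obtain ⟨x, hx, h⟩ := perfect_simple (hR J h0)
  obtain ⟨c, rfl⟩ := Ideal.Quotient.mk_surjective x
  have hc : c ∉ J := fun hc => hx (Ideal.Quotient.eq_zero_iff_mem.2 hc)
  let m : Ideal R := Submodule.comap (LinearMap.toSpanSingleton R R c) J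
  have hm : ∀ s, s ∈ m ↔ s * c ∈ J := fun s => Iff.rfl
  refine ⟨c, hc, m, ?_, hm⟩
  rw [Ideal.isMaximal_iff]
  refine ⟨by rwa [hm, one_mul], fun K s hK hs hsK => ?_⟩
  obtain ⟨t, ht⟩ := h (Ideal.Quotient.mk J s) (by
    rw [← map_mul]
    exact fun hz => hs ((hm s).2 (Ideal.Quotient.eq_zero_iff_mem.1 hz)))
  obtain ⟨t, rfl⟩ := Ideal.Quotient.mk_surjective t
  rw [← map_mul, ← map_mul, Ideal.Quotient.eq] at ht
  have h2 : t * s - 1 ∈ K := hK ((hm _).2 (by convert ht using 1; ring))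
  have h3 := K.sub_mem (K.mul_mem_left t hsK) h2
  rwa [sub_sub_cancel] at h3

theorem apd_assoc {R : Type u} [CommRing R] [IsDomain R] (hR : IsAPD R) (m : Ideal R)
    (hm : m.IsMaximal) (r : R) (hr : r ≠ 0) (hrm : r ∈ m) :
    ∃ c : R, ∀ s, s ∈ m ↔ s * c ∈ Ideal.span {r} := by
  have h0 : Ideal.span {r} ≠ ⊥ := by rwa [Ne, Ideal.span_singleton_eq_bot]
  have hle : Ideal.span {r} ≤ m := by rwa [Ideal.span_singleton_le_iff_mem]
  have hker : RingHom.ker (Ideal.Quotient.mk (Ideal.span {r})) ≤ m := by rwa [Ideal.mk_ker]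
  have hmax : (m.map (Ideal.Quotient.mk (Ideal.span {r}))).IsMaximal :=
    Ideal.IsMaximal.map_of_surjective_of_ker_le Ideal.Quotient.mk_surjective hker
  obtain ⟨x, hx⟩ := perfect_assoc (hR _ h0) (m.map (Ideal.Quotient.mk (Ideal.span {r})))
  obtain ⟨c, rfl⟩ := Ideal.Quotient.mk_surjective x
  refine ⟨c, fun s => ?_⟩
  rw [← Ideal.Quotient.eq_zero_iff_mem (I := Ideal.span {r}), map_mul, hx]
  constructor
  · exact fun h => Ideal.mem_map_of_mem _ h
  · intro h
    rw [Ideal.mem_map_iff_of_surjective _ Ideal.Quotient.mk_surjective] at h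
    obtain ⟨y, hy, hys⟩ := h
    rw [Ideal.Quotient.eq] at hys
    have := m.sub_mem hy (hle hys)
    rwa [sub_sub_cancel] at this

/-- Extension from maximal ideals suffices. -/
theorem baer_of_maximal {R : Type u} [CommRing R] [IsDomain R] (hR : IsAPD R)
    (N : Type u) [AddCommGroup N] [Module R N]
    (H : ∀ m : Ideal R, m.IsMaximal → ∀ g : m →ₗ[R] N, ∃ n : N, ∀ a : m, g a = (a : R) • n) :
    Module.Baer R N := by
  intro I g
  by_cases hI : I = ⊥
  · subst hI
    refine ⟨0, fun x hx => ?_⟩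
    have : (⟨x, hx⟩ : (⊥ : Ideal R)) = 0 := Subtype.ext hx
    rw [this, map_zero, LinearMap.zero_apply]
  let p : R →ₗ.[R] N := ⟨I, g⟩
  obtain ⟨q, hpq, hq⟩ := zorn_le_nonempty_Ici₀ p
    (fun c _ hc y _ => ⟨LinearPMap.sSup c hc.directedOn, fun z hz => LinearPMap.le_sSup _ hz⟩)
    p le_rfl
  have htop : q.domain = ⊤ := by
    by_contra hne
    have hb : q.domain ≠ ⊥ := fun h => hI (by
      have := hpq.1
      rw [h] at this
      exact le_bot_iff.1 this)
    obtain ⟨c, hc, m, hm, hmc⟩ := apd_simple hR q.domain hb hne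
    have hc0 : c ≠ 0 := fun h => hc (h ▸ q.domain.zero_mem)
    let φ : m →ₗ[R] q.domain := LinearMap.codRestrict q.domain
      ((LinearMap.toSpanSingleton R R c) ∘ₗ m.subtype) (fun s => (hmc s).1 s.2)
    obtain ⟨n, hn⟩ := H m hm (q.toFun ∘ₗ φ)
    let k : R →ₗ.[R] N := LinearPMap.mkSpanSingleton' c n (fun s hs => by
      rw [smul_eq_mul, mul_eq_zero, or_iff_left hc0] at hs
      rw [hs, map_zero, zero_smul])
    have hk : ∀ (x : q.domain) (y : k.domain), (x : R) = y → q x = k y := by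
      rintro ⟨x, hx⟩ ⟨y, hy⟩ hxy
      obtain ⟨s, rfl⟩ := Submodule.mem_span_singleton.1 hy
      dsimp only at hxy
      subst hxy
      have := hn ⟨s, (hmc s).2 hx⟩
      erw [LinearPMap.mkSpanSingleton'_apply]
      exact this
    have := hq (q.left_le_sup k hk)
    exact hc (this.1 ((q.right_le_sup k hk).1 (Submodule.mem_span_singleton_self c)))
  refine ⟨q.toFun ∘ₗ LinearMap.codRestrict q.domain LinearMap.id (fun x => htop ▸ trivial),
    fun x hx => ?_⟩
  exact (hpq.2 (x := ⟨x, hx⟩) rfl).symm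

theorem divisible_of_injective {R : Type u} [CommRing R] [IsDomain R]
    (E : Type u) [AddCommGroup E] [Module R E] (hE : Module.Injective R E) :
    IsDivisibleModule R E := by
  intro r hr x
  obtain ⟨h, hh⟩ := hE.out (LinearMap.toSpanSingleton R R r)
    (fun a b hab => by simpa [hr] using hab) (LinearMap.toSpanSingleton R E x)
  refine ⟨h 1, ?_⟩
  have := hh 1
  rw [LinearMap.toSpanSingleton_apply, LinearMap.toSpanSingleton_apply, one_smul, one_smul] at this
  rw [← map_smul, smul_eq_mul, mul_one, this]

theorem key_injective {R : Type u} [CommRing R] [IsDomain R] (hR : IsAPD R) (hQ : ¬ IsField R)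
    (N E F : Type u) [AddCommGroup N] [Module R N] [AddCommGroup E] [Module R E]
    [AddCommGroup F] [Module R F] (i : N →ₗ[R] E) (p : E →ₗ[R] F)
    (hi : Function.Injective i) (hp : Function.Surjective p)
    (hip : LinearMap.range i = LinearMap.ker p)
    (hN : IsDivisibleModule R N) (hE : Module.Injective R E) (hF : Module.Injective R F) :
    Module.Injective R N := by
  apply Module.Baer.injective
  apply baer_of_maximal hR
  intro m hm g
  have hpi : ∀ n, p (i n) = 0 := fun n => by
    have : i n ∈ LinearMap.ker p := hip ▸ ⟨n, rfl⟩
    exact this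
  have hmb : m ≠ ⊥ := Ring.ne_bot_of_isMaximal_of_not_isField hm hQ
  obtain ⟨r, hrm, hr⟩ := Submodule.exists_mem_ne_zero_of_ne_bot hmb
  obtain ⟨c, hc⟩ := apd_assoc hR m hm r hr hrm
  obtain ⟨h, hh⟩ := hE.out m.subtype Subtype.val_injective (i ∘ₗ g)
  set e := h 1 with he
  have hge : ∀ a : m, i (g a) = (a : R) • e := by
    intro a
    rw [he, ← map_smul, smul_eq_mul, mul_one]
    exact (hh a).symm
  have hu : ∀ a ∈ m, a • p e = 0 := by
    intro a ha
    rw [← map_smul, ← hge ⟨a, ha⟩, hpi]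
  let I := Ideal.span {r}
  let x : R ⧸ I := Submodule.Quotient.mk c
  have hx : ∀ s : R, s • x = 0 ↔ s ∈ m := by
    intro s
    rw [hc]
    change (Submodule.Quotient.mk (s • c) : R ⧸ I) = 0 ↔ _
    rw [Submodule.Quotient.mk_eq_zero, smul_eq_mul]
  let j : (R ⧸ m) →ₗ[R] (R ⧸ I) := Submodule.liftQ m (LinearMap.toSpanSingleton R _ x)
    (fun s hs => (hx s).2 hs)
  have hj : Function.Injective j := by
    rw [← LinearMap.ker_eq_bot]
    apply Submodule.ker_liftQ_eq_bot
    intro s hs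
    exact (hx s).1 hs
  let k : (R ⧸ m) →ₗ[R] F := Submodule.liftQ m (LinearMap.toSpanSingleton R _ (p e))
    (fun s hs => hu s hs)
  obtain ⟨l, hl⟩ := hF.out j hj k
  obtain ⟨w0, hw0⟩ := hp (l (Submodule.Quotient.mk 1))
  have hcw : c • p w0 = p e := by
    have h1 := hl (Submodule.Quotient.mk 1)
    have h2 : k (Submodule.Quotient.mk 1) = p e := by
      change (1 : R) • p e = p e
      rw [one_smul]
    have h3 : j (Submodule.Quotient.mk 1) = c • (Submodule.Quotient.mk 1 : R ⧸ I) := by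
      change (1 : R) • x = (Submodule.Quotient.mk (c • 1) : R ⧸ I)
      rw [one_smul, smul_eq_mul, mul_one]
    rw [h2, h3, map_smul, ← hw0] at h1
    exact h1
  have hrw : r • p w0 = 0 := by
    rw [hw0, ← map_smul]
    have : r • (Submodule.Quotient.mk 1 : R ⧸ I) = 0 := by
      rw [← Submodule.Quotient.mk_smul, Submodule.Quotient.mk_eq_zero, smul_eq_mul, mul_one]
      exact Ideal.mem_span_singleton_self r
    rw [this, map_zero]
  have hrw' : r • w0 ∈ LinearMap.range i := by
    rw [hip, LinearMap.mem_ker, map_smul, hrw]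
  obtain ⟨n0, hn0⟩ := hrw'
  obtain ⟨n1, rfl⟩ := hN r hr n0
  set v := w0 - i n1 with hv
  have hrv : r • v = 0 := by
    rw [hv, smul_sub, ← map_smul, hn0, sub_self]
  have hpv : p (e - c • v) = 0 := by
    rw [map_sub, map_smul, hv, map_sub, hpi, sub_zero, hcw, sub_self]
  have hmem : e - c • v ∈ LinearMap.range i := by
    rw [hip]; exact hpv
  obtain ⟨n, hn⟩ := hmem
  refine ⟨n, fun a => hi ?_⟩
  obtain ⟨t, ht⟩ := Ideal.mem_span_singleton'.1 ((hc a).1 a.2)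
  rw [hge, map_smul, hn, smul_sub, smul_smul, ← ht, mul_smul, hrv, smul_zero, sub_zero]

theorem cokernel_facts {R : Type u} [CommRing R] {M E : ModuleCat.{u} R} (f : M ⟶ E) :
    Function.Surjective (cokernel.π f).hom ∧
      LinearMap.range f.hom = LinearMap.ker (cokernel.π f).hom := by
  refine ⟨(ModuleCat.epi_iff_surjective _).1 inferInstance, ?_⟩
  exact (ShortComplex.moduleCat_exact_iff_range_eq_ker _).1 (ShortComplex.exact_cokernel f)

theorem step_two {R : Type u} [CommRing R] [IsDomain R]
    (hR : IsAPD R) (hQ : ¬ IsField R) (M : ModuleCat.{u} R)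
    (h : InjDimLE R 2 M) : InjDimLE R 1 M := by
  obtain ⟨E, f, hf, hE, E', f', hf', hE', hF⟩ := h
  refine ⟨E, f, hf, hE, ?_⟩
  change Injective (cokernel f') at hF
  change Injective (cokernel f)
  have hE1 := (Module.injective_iff_injective_object R E).2 hE
  have hE2 := (Module.injective_iff_injective_object R E').2 hE'
  have hE3 := (Module.injective_iff_injective_object R (cokernel f' : ModuleCat.{u} R)).2 hF
  apply (Module.injective_iff_injective_object R (cokernel f : ModuleCat.{u} R)).1
  refine key_injective hR hQ _ _ _ f'.hom (cokernel.π f').hom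
    ((ModuleCat.mono_iff_injective _).1 hf') (cokernel_facts f').1 (cokernel_facts f').2 ?_ hE2 hE3
  intro r hr y
  obtain ⟨x, rfl⟩ := (cokernel_facts f).1 y
  obtain ⟨z, rfl⟩ := divisible_of_injective E hE1 r hr x
  exact ⟨(cokernel.π f).hom z, (map_smul _ _ _).symm⟩

theorem step_all {R : Type u} [CommRing R] [IsDomain R]
    (hR : IsAPD R) (hQ : ¬ IsField R) (n : ℕ) : ∀ M : ModuleCat.{u} R,
    InjDimLE R (n + 1) M → InjDimLE R 1 M := by
  induction n with
  | zero => exact fun M h => h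
  | succ n ih =>
    rintro M ⟨E, f, hf, hE, h⟩
    exact step_two hR hQ M ⟨E, f, hf, hE, ih _ h⟩

end Helpers

/-- Over an almost perfect domain that is not a field, any module of finite injective
dimension has injective dimension at most `1`. -/
theorem injDimLE_one_of_finite (R : Type u) [CommRing R] [IsDomain R]
    (hR : IsAPD R) (hQ : ¬ IsField R) (M : ModuleCat.{u} R)
    (h : ∃ n : ℕ, InjDimLE R n M) : InjDimLE R 1 M := by
  obtain ⟨n, hn⟩ := h
  cases n with
  | zero =>
    have hM : Injective M := hn
    refine ⟨M, 𝟙 M, inferInstance, hM, ?_⟩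
    change Injective (cokernel (𝟙 M))
    exact (isZero_cokernel_of_epi (𝟙 M)).injective
  | succ n => exact step_all hR hQ n M hn
end

section
/- Let R be an almost perfect domain with Q ≠ R. If an R-module M has finite projective dimension, then its projective dimension is at most 1. -/
universe u

open CategoryTheory Limits

namespace APDProof

theorem proj_eq_zero {B : Type*} [CommRing B] {P : Type*} [AddCommGroup P] [Module B P]
    [Module.Projective B P] (J : Ideal B) (hJ : J ≤ Ideal.jacobson ⊥)
    (h : J • (⊤ : Submodule B P) = ⊤) (x : P) : x = 0 := by
  classical
  obtain ⟨s, hs⟩ := Module.projective_def'.mp (inferInstance : Module.Projective B P)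
  have hs' : ∀ p, Finsupp.linearCombination B id (s p) = p := fun p => LinearMap.congr_fun hs p
  have hc : ∀ p q : P, s p q ∈ J := by
    intro p q
    have hp : p ∈ J • (⊤ : Submodule B P) := by rw [h]; trivial
    refine Submodule.smul_induction_on hp ?_ ?_
    · intro r hr n _
      rw [map_smul, Finsupp.smul_apply, smul_eq_mul]
      exact J.mul_mem_right _ hr
    · intro a b ha hb
      rw [map_add, Finsupp.add_apply]
      exact J.add_mem ha hb
  let I : Ideal B := Ideal.span ((s x).support.image (s x) : Finset B)
  have hI : I ≤ J • I := by
    rw [Ideal.span_le]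
    intro a ha
    simp only [Finset.coe_image, Set.mem_image, Finset.mem_coe] at ha
    obtain ⟨q, hq, rfl⟩ := ha
    have h1 : s x q = (s x).sum (fun p a => a * s p q) := by
      conv_lhs => rw [← hs' x]
      rw [Finsupp.linearCombination_apply, Finsupp.sum, map_sum, Finsupp.finsetSum_apply, Finsupp.sum]
      simp
    rw [h1]
    refine Submodule.sum_mem _ fun p hp => ?_
    show s x p * s p q ∈ _
    rw [mul_comm]
    refine Submodule.smul_mem_smul (hc p q) (Ideal.subset_span ?_)
    simp only [Finset.coe_image, Set.mem_image, Finset.mem_coe]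
    exact ⟨p, hp, rfl⟩
  have hI0 : I = ⊥ := Submodule.eq_bot_of_le_smul_of_le_jacobson_bot J I ⟨_, rfl⟩ hI hJ
  have : s x = 0 := by
    ext q
    by_contra hq
    apply hq
    have : s x q ∈ I := Ideal.subset_span (by
      simp only [Finset.coe_image, Set.mem_image, Finset.mem_coe]
      exact ⟨q, by simpa using hq, rfl⟩)
    rw [hI0] at this
    simpa using this
  rw [← hs' x, this, map_zero]

theorem nakayama {B : Type u} [CommRing B] (hB : IsPerfectRing B) {X : Type u} [AddCommGroup X]
    [Module B X] (h : (Ideal.jacobson ⊥ : Ideal B) • (⊤ : Submodule B X) = ⊤) (x : X) : x = 0 := by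
  obtain ⟨P, _, _, f, hP, hf, hN⟩ := hB X _ _
  have h1 : (Ideal.jacobson ⊥ : Ideal B) • (⊤ : Submodule B P) = ⊤ := by
    apply hN
    rw [eq_top_iff]
    intro p _
    have : f p ∈ Submodule.map f ((Ideal.jacobson ⊥ : Ideal B) • (⊤ : Submodule B P)) := by
      rw [Submodule.map_smul'', Submodule.map_top, LinearMap.range_eq_top.mpr hf, h]; trivial
    obtain ⟨q, hq, hqp⟩ := this
    rw [Submodule.mem_sup]
    exact ⟨q, hq, p - q, by simp [hqp], by simp⟩
  obtain ⟨p, rfl⟩ := hf x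
  rw [proj_eq_zero _ le_rfl h1 p, map_zero]

theorem t_nil {B : Type u} [CommRing B] (hB : IsPerfectRing B) (c : ℕ → B)
    (hc : ∀ i, c i ∈ (Ideal.jacobson ⊥ : Ideal B)) : ∃ n, ∏ i ∈ Finset.range n, c i = 0 := by
  let Φ : (ℕ →₀ B) →ₗ[B] (ℕ →₀ B) :=
    Finsupp.linearCombination B (fun i => Finsupp.single i 1 - c i • Finsupp.single (i+1) 1)
  let X := (ℕ →₀ B) ⧸ LinearMap.range Φ
  let π : (ℕ →₀ B) →ₗ[B] X := (LinearMap.range Φ).mkQ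
  have hπ : Function.Surjective π := Submodule.mkQ_surjective _
  have hΦ0 : ∀ d, π (Φ d) = 0 := fun d =>
    (Submodule.Quotient.mk_eq_zero _).mpr ⟨d, rfl⟩
  have hst : ∀ i, π (Finsupp.single i 1) = c i • π (Finsupp.single (i+1) 1) := by
    intro i
    have := hΦ0 (Finsupp.single i 1)
    simp only [Φ, Finsupp.linearCombination_single, one_smul, map_sub, map_smul] at this
    exact sub_eq_zero.mp this
  have h : (Ideal.jacobson ⊥ : Ideal B) • (⊤ : Submodule B X) = ⊤ := by
    rw [eq_top_iff]
    rintro x -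
    obtain ⟨y, rfl⟩ := hπ x
    induction y using Finsupp.induction_linear with
    | zero => simp
    | add f g hf hg => rw [map_add]; exact Submodule.add_mem _ hf hg
    | single i b =>
      have : Finsupp.single i b = b • Finsupp.single i (1:B) := by simp
      rw [this, map_smul, hst]
      exact Submodule.smul_mem _ _ (Submodule.smul_mem_smul (hc i) trivial)
  have h0 : π (Finsupp.single 0 1) = 0 := nakayama hB h _
  have h1 : (Finsupp.single 0 1 : ℕ →₀ B) ∈ LinearMap.range Φ :=
    (Submodule.Quotient.mk_eq_zero _).mp h0
  obtain ⟨d, hd⟩ := h1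
  have e0 : ∀ d, Φ d 0 = d 0 := by
    intro d
    induction d using Finsupp.induction_linear with
    | zero => simp
    | add f g hf hg => simp [hf, hg]
    | single i b => simp [Φ, Finsupp.single_apply]
  have e1 : ∀ n d, Φ d (n+1) = d (n+1) - c n * d n := by
    intro n d
    induction d using Finsupp.induction_linear with
    | zero => simp
    | add f g hf hg => simp [hf, hg]; ring
    | single i b =>
      simp only [Φ, Finsupp.linearCombination_single, Finsupp.smul_apply, Finsupp.sub_apply,
        Finsupp.single_apply, smul_eq_mul]
      by_cases h1 : i = n + 1
      · subst h1; simp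
      · by_cases h2 : i = n
        · subst h2; simp; ring
        · simp [h1, h2]
  have e2 : ∀ n, d n = ∏ i ∈ Finset.range n, c i := by
    intro n
    induction n with
    | zero => rw [← e0, hd]; simp
    | succ n ih =>
      have := e1 n d
      rw [hd] at this
      simp at this
      rw [Finset.prod_range_succ, ← ih, mul_comm]
      exact (sub_eq_zero.mp this.symm)
  obtain ⟨n, hn⟩ := Infinite.exists_notMem_finset d.support
  exact ⟨n, by rw [← e2]; simpa using hn⟩

theorem socle {B : Type u} [CommRing B] [IsLocalRing B] (hB : IsPerfectRing B) :
    ∃ a : B, a ≠ 0 ∧ ∀ c ∈ IsLocalRing.maximalIdeal B, c * a = 0 := by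
  by_contra! hcon
  choose! φ hφ hφ' using hcon
  let a : ℕ → B := fun n => Nat.rec 1 (fun _ x => φ x * x) n
  have ha : ∀ n, a n ≠ 0 := by
    intro n
    induction n with
    | zero => exact one_ne_zero
    | succ n ih => exact hφ' _ ih
  obtain ⟨n, hn⟩ := t_nil hB (fun i => φ (a i)) (fun i => by
    rw [IsLocalRing.jacobson_eq_maximalIdeal ⊥ bot_ne_top]; exact hφ _ (ha i))
  have : ∀ n, ∏ i ∈ Finset.range n, φ (a i) = a n := by
    intro n
    induction n with
    | zero => rfl
    | succ n ih => rw [Finset.prod_range_succ, ih, mul_comm]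
  exact ha n (by rw [← this, hn])

theorem free_of_pd_one {C : Type u} [CommRing C] [IsLocalRing C] (hC : IsPerfectRing C)
    {P₁ P₀ X : Type u} [AddCommGroup P₁] [Module C P₁] [AddCommGroup P₀] [Module C P₀]
    [AddCommGroup X] [Module C X] [Module.Projective C P₁] [Module.Projective C P₀]
    (i : P₁ →ₗ[C] P₀) (π : P₀ →ₗ[C] X) (hi : Function.Injective i)
    (hπ : Function.Surjective π) (hex : Function.Exact i π) : Module.Free C X := by
  classical
  let m := IsLocalRing.maximalIdeal C
  have hm : (Ideal.jacobson ⊥ : Ideal C) = m :=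
    IsLocalRing.jacobson_eq_maximalIdeal ⊥ bot_ne_top
  let _ : Field (C ⧸ m) := Ideal.Quotient.field m
  let Y := X ⧸ (m • (⊤ : Submodule C X))
  let b := Module.Basis.ofVectorSpace (C ⧸ m) Y
  let q : X →ₗ[C] Y := (m • (⊤ : Submodule C X)).mkQ
  have hq : Function.Surjective q := Submodule.mkQ_surjective _
  choose v hv using fun j => hq (b j)
  let G := (Module.Basis.ofVectorSpaceIndex (C ⧸ m) Y) →₀ C
  let φ : G →ₗ[C] X := Finsupp.linearCombination C v
  have hsurj : Function.Surjective φ := by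
    let Z := X ⧸ LinearMap.range φ
    let z : X →ₗ[C] Z := (LinearMap.range φ).mkQ
    have hz : Function.Surjective z := Submodule.mkQ_surjective _
    have h : (Ideal.jacobson ⊥ : Ideal C) • (⊤ : Submodule C Z) = ⊤ := by
      rw [hm, eq_top_iff]
      rintro w -
      obtain ⟨x, rfl⟩ := hz w
      have : ∃ g : G, q (φ g) = q x := by
        have hx := b.linearCombination_repr (q x)
        choose l hl using fun j => Ideal.Quotient.mk_surjective (b.repr (q x) j)
        refine ⟨∑ j ∈ (b.repr (q x)).support, Finsupp.single j (l j), ?_⟩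
        rw [map_sum, map_sum]
        conv_rhs => rw [← hx, Finsupp.linearCombination_apply, Finsupp.sum]
        refine Finset.sum_congr rfl fun j _ => ?_
        rw [← hl j]
        have h5 : φ (Finsupp.single j (l j)) = l j • v j := Finsupp.linearCombination_single _ _ _
        rw [h5, map_smul, hv]
        rfl
      obtain ⟨g, hg⟩ := this
      have h2 : x - φ g ∈ m • (⊤ : Submodule C X) := by
        have : q (x - φ g) = 0 := by rw [map_sub, hg, sub_self]
        exact (Submodule.Quotient.mk_eq_zero _).mp this
      have h3 : z x = z (x - φ g) := by
        have : z (φ g) = 0 := (Submodule.Quotient.mk_eq_zero _).mpr ⟨g, rfl⟩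
        rw [map_sub, this, sub_zero]
      rw [h3]
      have := Submodule.mem_map_of_mem (f := z) h2
      rw [Submodule.map_smul''] at this
      exact Submodule.smul_mono le_rfl le_top this
    intro x
    have := nakayama hC h (z x)
    exact (Submodule.Quotient.mk_eq_zero _).mp this
  have hker : ∀ l ∈ LinearMap.ker φ, ∀ j, l j ∈ m := by
    intro l hl j
    have h1 : q (φ l) = 0 := by rw [LinearMap.mem_ker.mp hl, map_zero]
    let l' := l.mapRange (Ideal.Quotient.mk m) (map_zero _)
    have h2 : Finsupp.linearCombination (C ⧸ m) b l' = 0 := by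
      rw [← h1, Finsupp.linearCombination_apply, Finsupp.sum_mapRange_index (by simp),
        Finsupp.linearCombination_apply, Finsupp.sum, Finsupp.sum, map_sum]
      refine Finset.sum_congr rfl fun j _ => ?_
      rw [map_smul, hv]
      rfl
    have h3 : l' = 0 := by
      have := b.linearIndependent
      rw [linearIndependent_iff] at this
      exact this _ h2
    have h4 : l' j = 0 := by rw [h3]; rfl
    exact Ideal.Quotient.eq_zero_iff_mem.mp (by simpa [l'] using h4)
  -- the kernel is projective
  obtain ⟨α, hα⟩ := Module.projective_lifting_property π φ hπ
  obtain ⟨β, hβ⟩ := Module.projective_lifting_property φ π hsurj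
  have hα' : ∀ g, π (α g) = φ g := fun g => LinearMap.congr_fun hα g
  have hβ' : ∀ g, φ (β g) = π g := fun g => LinearMap.congr_fun hβ g
  let L := LinearMap.ker φ
  let e1 : P₁ ≃ₗ[C] LinearMap.ker π :=
    (LinearEquiv.ofInjective i hi).trans (LinearEquiv.ofEq _ _ hex.linearMap_ker_eq.symm)
  have : Module.Projective C (LinearMap.ker π) := Module.Projective.of_equiv e1
  let s1 : L →ₗ[C] LinearMap.ker π := (α.comp L.subtype).codRestrict _ (fun l => by
    rw [LinearMap.mem_ker]; simp only [LinearMap.comp_apply, hα']; exact l.2)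
  let s : L →ₗ[C] (LinearMap.ker π × G) := s1.prod L.subtype
  let t : (LinearMap.ker π × G) →ₗ[C] L :=
    LinearMap.codRestrict L ((β.comp (LinearMap.ker π).subtype).coprod
      (LinearMap.id - β.comp α)) (by
      rintro ⟨p, g⟩
      have := p.2
      rw [LinearMap.mem_ker] at this
      simp [L, hβ', hα', this])
  have hts : t.comp s = LinearMap.id := by
    ext l
    simp [t, s, s1]
  have hLp : Module.Projective C L := Module.Projective.of_split s t hts
  obtain ⟨a, ha0, ha⟩ := socle hC
  have haL : ∀ l : L, a • l = 0 := by
    intro l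
    ext j
    have := ha _ (hker l.1 l.2 j)
    rw [mul_comm] at this
    exact this
  have hL : m • (⊤ : Submodule C L) = ⊤ := by
    rw [eq_top_iff]
    rintro l -
    obtain ⟨σ, hσ⟩ := Module.projective_def'.mp hLp
    have h1 : Finsupp.linearCombination C id (σ l) = l := LinearMap.congr_fun hσ l
    rw [← h1, Finsupp.linearCombination_apply]
    refine Submodule.sum_mem _ fun p _ => Submodule.smul_mem_smul ?_ trivial
    rw [IsLocalRing.mem_maximalIdeal, mem_nonunits_iff]
    intro hu
    have h2 : a * σ l p = 0 := by
      have : σ (a • l) = 0 := by rw [haL, map_zero]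
      rw [map_smul] at this
      have := DFunLike.congr_fun this p
      simpa using this
    exact ha0 ((hu.mul_left_eq_zero).mp h2)
  have hinj : Function.Injective φ := by
    rw [← LinearMap.ker_eq_bot, Submodule.eq_bot_iff]
    intro l hl
    have := proj_eq_zero (P := L) m hm.ge hL ⟨l, hl⟩
    simpa using this
  exact Module.Free.of_equiv (LinearEquiv.ofBijective φ ⟨hinj, hsurj⟩)

theorem exists_idem {B : Type u} [CommRing B] (hB : IsPerfectRing B) (n : Ideal B)
    [hn : n.IsMaximal] : ∃ e : B, e * e = e ∧ e ∉ n ∧ ∀ n' : Ideal B, n'.IsMaximal → n' ≠ n → e ∈ n' := by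
  obtain ⟨P, _, _, f, hP, hf, hN⟩ := hB (B ⧸ n) _ _
  obtain ⟨p, hp⟩ := hf 1
  let g : B →ₗ[B] P := LinearMap.toSpanSingleton B P p
  have hg : Function.Surjective g := by
    rw [← LinearMap.range_eq_top]
    apply hN
    rw [eq_top_iff]
    rintro x -
    obtain ⟨b, hb⟩ := Ideal.Quotient.mk_surjective (f x)
    rw [Submodule.mem_sup]
    refine ⟨g b, ⟨b, rfl⟩, x - g b, ?_, by simp⟩
    rw [LinearMap.mem_ker, map_sub]
    simp only [g, LinearMap.toSpanSingleton_apply, map_smul, hp, ← hb]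
    rw [sub_eq_zero, Algebra.smul_def, mul_one]
    rfl
  obtain ⟨s, hs⟩ := Module.projective_lifting_property g LinearMap.id hg
  have hs' : ∀ x, g (s x) = x := fun x => LinearMap.congr_fun hs x
  have hgb : ∀ b, g b = b • p := fun b => rfl
  have hfg : ∀ b, f (g b) = Ideal.Quotient.mk n b := fun b => by
    rw [hgb, map_smul, hp, Algebra.smul_def, mul_one]; rfl
  have hsp : ∀ b, s (b • p) = b * s p := fun b => by rw [map_smul, smul_eq_mul]
  have hep : s p • p = p := by rw [← hgb, hs']
  refine ⟨s p, ?_, ?_, ?_⟩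
  · rw [← hsp, hep]
  · intro h
    have := hfg (s p)
    rw [hs', hp, Ideal.Quotient.eq_zero_iff_mem.mpr h] at this
    exact one_ne_zero this
  · intro n' hn' hne
    have hsup : n' ⊔ n = ⊤ := hn'.coprime_of_ne hn hne
    have h1 : Submodule.map g n' = ⊤ := by
      apply hN
      rw [eq_top_iff]
      rintro x -
      obtain ⟨b, rfl⟩ := hg x
      have hb : b ∈ n' ⊔ n := by rw [hsup]; trivial
      obtain ⟨y, hy, z, hz, rfl⟩ := Submodule.mem_sup.mp hb
      rw [map_add]
      refine Submodule.add_mem_sup ⟨y, hy, rfl⟩ ?_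
      rw [LinearMap.mem_ker, hfg]
      exact Ideal.Quotient.eq_zero_iff_mem.mpr hz
    have h2 : p ∈ Submodule.map g n' := by rw [h1]; trivial
    obtain ⟨y, hy, hyp⟩ := h2
    have : s p = y * s p := by rw [← hsp, ← hgb, hyp]
    rw [this]
    exact n'.mul_mem_right _ hy

section
variable {R : Type u} [CommRing R] [IsDomain R]

theorem exists_e' (hR : IsAPD R) (m : Ideal R) [hm : m.IsMaximal] (t : R) (ht : t ≠ 0)
    (htm : t ∈ m) : ∃ e : R, e ∉ m ∧ (∃ c, e * (e - 1) = t * c) ∧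
      ∀ m' : Ideal R, m'.IsMaximal → t ∈ m' → m' ≠ m → e ∈ m' := by
  let I : Ideal R := Ideal.span {t}
  have hI : I ≠ ⊥ := by simpa [I] using ht
  have hle : ∀ m' : Ideal R, t ∈ m' → I ≤ m' := fun m' h => by
    rw [Ideal.span_le]; simpa using h
  have hmax : ∀ m' : Ideal R, m'.IsMaximal → t ∈ m' → (m'.map (Ideal.Quotient.mk I)).IsMaximal := by
    intro m' hm' h
    refine (Ideal.map_eq_top_or_isMaximal_of_surjective _ Ideal.Quotient.mk_surjective hm').resolve_left ?_
    intro htop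
    have : Ideal.Quotient.mk I 1 ∈ m'.map (Ideal.Quotient.mk I) := by rw [htop]; trivial
    rw [Ideal.mem_quotient_iff_mem (hle m' h)] at this
    exact hm'.ne_top ((Ideal.eq_top_iff_one _).mpr this)
  have := hmax m hm htm
  obtain ⟨e, he, hem, hem'⟩ := exists_idem (hR I hI) (m.map (Ideal.Quotient.mk I))
  obtain ⟨e, rfl⟩ := Ideal.Quotient.mk_surjective e
  refine ⟨e, ?_, ?_, ?_⟩
  · rwa [Ideal.mem_quotient_iff_mem (hle m htm)] at hem
  · rw [← map_mul, Ideal.Quotient.eq, Ideal.mem_span_singleton'] at he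
    obtain ⟨c, hc⟩ := he
    exact ⟨c, by rw [mul_comm t c, hc]; ring⟩
  · intro m' hm' h hne
    have := hem' _ (hmax m' hm' h) (by
      intro heq
      apply hne
      ext x
      rw [← Ideal.mem_quotient_iff_mem (hle m' h), heq, Ideal.mem_quotient_iff_mem (hle m htm)])
    rwa [Ideal.mem_quotient_iff_mem (hle m' h)] at this

theorem exists_e (hR : IsAPD R) (m : Ideal R) [hm : m.IsMaximal] (t : R) (ht : t ≠ 0) :
    ∃ e : R, (∃ u, u ∉ m ∧ ∃ c, u * (e - 1) = t * c) ∧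
      ∀ m' : Ideal R, m'.IsMaximal → m' ≠ m → ∃ u, u ∉ m' ∧ ∃ c, u * e = t * c := by
  by_cases htm : t ∈ m
  · obtain ⟨e, he, ⟨c, hc⟩, h⟩ := exists_e' hR m t ht htm
    refine ⟨e, ⟨e, he, c, hc⟩, fun m' hm' hne => ?_⟩
    by_cases htm' : t ∈ m'
    · refine ⟨e - 1, fun h1 => ?_, c, by rw [mul_comm, hc]⟩
      have := m'.sub_mem (h m' hm' htm' hne) h1
      rw [sub_sub_cancel] at this
      exact hm'.ne_top ((Ideal.eq_top_iff_one _).mpr this)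
    · exact ⟨t, htm', e, rfl⟩
  · exact ⟨0, ⟨t, htm, -1, by simp⟩, fun m' hm' _ => ⟨1, hm'.isPrime.one_notMem, 0, by simp⟩⟩

theorem finite_max (hR : IsAPD R) (t : R) (ht : t ≠ 0) :
    {m : Ideal R | m.IsMaximal ∧ t ∈ m}.Finite := by
  classical
  let S := {m : Ideal R | m.IsMaximal ∧ t ∈ m}
  have H : ∀ m : S, ∃ e : R, e ∉ m.1 ∧ ∀ m' : S, m' ≠ m → e ∈ m'.1 := by
    rintro ⟨m, hm, htm⟩
    obtain ⟨e, he, _, h⟩ := exists_e' hR m t ht htm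
    exact ⟨e, he, fun m' hne => h m'.1 m'.2.1 m'.2.2 (fun h => hne (Subtype.ext h))⟩
  choose e he he' using H
  have h1 : (1 : R) ∈ Ideal.span (insert t (Set.range e)) := by
    rw [← Ideal.eq_top_iff_one]
    by_contra hne
    obtain ⟨m, hm, hle⟩ := Ideal.exists_le_maximal _ hne
    have htm : t ∈ m := hle (Ideal.subset_span (by simp))
    exact he ⟨m, hm, htm⟩ (hle (Ideal.subset_span (by simp)))
  obtain ⟨T, hT, h1T⟩ := Submodule.mem_span_finite_of_mem_span h1
  have hmem : ∀ m : S, e m ∈ T := by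
    intro m
    by_contra hn
    have : Ideal.span (T : Set R) ≤ m.1 := by
      rw [Ideal.span_le]
      intro x hx
      rcases hT hx with rfl | ⟨m', rfl⟩
      · exact m.2.2
      · refine he' m' m ?_
        rintro rfl
        exact hn hx
    exact m.2.1.isPrime.one_notMem (this h1T)
  have hinj : Function.Injective (fun m : S => (⟨e m, hmem m⟩ : T)) := by
    intro m m' h
    by_contra hne
    have h2 : e m = e m' := congrArg Subtype.val h
    exact he m (h2 ▸ he' m' m hne)
  have : Finite S := Finite.of_injective _ hinj
  exact Set.toFinite S

/-- the kernel of `R → R_m / t R_m` -/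
def locI (m : Ideal R) [hm : m.IsMaximal] (t : R) : Ideal R where
  carrier := {a | ∃ u, u ∉ m ∧ ∃ c, u * a = t * c}
  zero_mem' := ⟨1, hm.isPrime.one_notMem, 0, by simp⟩
  add_mem' := by
    rintro a b ⟨u, hu, c, hc⟩ ⟨v, hv, d, hd⟩
    exact ⟨u * v, fun h => (hm.isPrime.mem_or_mem h).elim hu hv, v * c + u * d, by
      linear_combination v * hc + u * hd⟩
  smul_mem' := by
    rintro r a ⟨u, hu, c, hc⟩
    exact ⟨u, hu, r * c, by simp only [smul_eq_mul]; linear_combination r * hc⟩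

theorem mem_locI (m : Ideal R) [hm : m.IsMaximal] (t a : R) :
    a ∈ locI m t ↔ ∃ u, u ∉ m ∧ ∃ c, u * a = t * c := Iff.rfl

theorem self_mem_locI (m : Ideal R) [hm : m.IsMaximal] (t : R) : t ∈ locI m t :=
  ⟨1, hm.isPrime.one_notMem, 1, by ring⟩

theorem locI_le (m : Ideal R) [hm : m.IsMaximal] (t : R) (ht : t ∈ m) : locI m t ≤ m := by
  rintro a ⟨u, hu, c, hc⟩
  have : u * a ∈ m := hc ▸ m.mul_mem_right _ ht
  exact (hm.isPrime.mem_or_mem this).resolve_left hu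

theorem locI_inv (hR : IsAPD R) (m : Ideal R) [hm : m.IsMaximal] (t : R) (ht : t ≠ 0) (u : R)
    (hu : u ∉ m) : ∃ v, v * u - 1 ∈ locI m t := by
  have htop : Ideal.span {u} ⊔ locI m t = ⊤ := by
    by_contra hne
    obtain ⟨m', hm', hle⟩ := Ideal.exists_le_maximal _ hne
    have hum' : u ∈ m' := hle (Ideal.mem_sup_left (Ideal.mem_span_singleton_self u))
    have hne' : m' ≠ m := by rintro rfl; exact hu hum'
    obtain ⟨e, h1, h2⟩ := exists_e hR m t ht
    have h3 : e - 1 ∈ m' := hle (Ideal.mem_sup_right h1)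
    have h4 : t ∈ m' := hle (Ideal.mem_sup_right (self_mem_locI m t))
    obtain ⟨w, hw, c, hc⟩ := h2 m' hm' hne'
    have h5 : w * e ∈ m' := hc ▸ m'.mul_mem_right _ h4
    have h6 := (hm'.isPrime.mem_or_mem h5).resolve_left hw
    have := m'.sub_mem h6 h3
    rw [sub_sub_cancel] at this
    exact hm'.isPrime.one_notMem this
  obtain ⟨x, hx, y, hy, hxy⟩ := Submodule.mem_sup.mp ((Ideal.eq_top_iff_one _).mp htop)
  obtain ⟨v, rfl⟩ := Ideal.mem_span_singleton'.mp hx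
  refine ⟨v, ?_⟩
  have : v * u - 1 = - y := by rw [← hxy]; ring
  rw [this]
  exact neg_mem hy

theorem locI_local (hR : IsAPD R) (m : Ideal R) [hm : m.IsMaximal] (t : R) (ht : t ≠ 0)
    (htm : t ∈ m) : IsLocalRing (R ⧸ locI m t) := by
  have hne : locI m t ≠ ⊤ := fun h => hm.ne_top (top_le_iff.mp (h ▸ locI_le m t htm))
  have : Nontrivial (R ⧸ locI m t) := Ideal.Quotient.nontrivial_iff.mpr hne
  have hun : ∀ u, u ∉ m → IsUnit (Ideal.Quotient.mk (locI m t) u) := by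
    intro u hu
    obtain ⟨v, hv⟩ := locI_inv hR m t ht u hu
    refine IsUnit.of_mul_eq_one_right (Ideal.Quotient.mk _ v) ?_
    rw [← map_mul, ← map_one (Ideal.Quotient.mk (locI m t)), Ideal.Quotient.eq]
    exact hv
  refine IsLocalRing.of_isUnit_or_isUnit_one_sub_self fun a => ?_
  obtain ⟨a, rfl⟩ := Ideal.Quotient.mk_surjective a
  by_cases ha : a ∈ m
  · right
    rw [← map_one (Ideal.Quotient.mk (locI m t)), ← map_sub]
    apply hun
    intro h
    have := m.add_mem h ha
    rw [sub_add_cancel] at this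
    exact hm.isPrime.one_notMem this
  · exact Or.inl (hun a ha)

theorem locI_perfect (hR : IsAPD R) (m : Ideal R) [hm : m.IsMaximal] (t : R) (ht : t ≠ 0) :
    IsPerfectRing (R ⧸ locI m t) := by
  apply hR
  intro h
  have := self_mem_locI m t
  rw [h] at this
  exact ht (by simpa using this)

/-- local nilpotency -/
theorem exists_pow (hR : IsAPD R) (m : Ideal R) [hm : m.IsMaximal] (r : R) (hr : r ∈ m) (s : R)
    (hs : s ≠ 0) : ∃ n u, u ∉ m ∧ ∃ c, u * r ^ n = s * c := by
  by_cases hsm : s ∈ m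
  · have := locI_local hR m s hs hsm
    obtain ⟨n, hn⟩ := t_nil (locI_perfect hR m s hs) (fun _ => Ideal.Quotient.mk _ r) (fun _ => by
      rw [IsLocalRing.jacobson_eq_maximalIdeal ⊥ bot_ne_top, IsLocalRing.mem_maximalIdeal,
        mem_nonunits_iff]
      intro hu
      obtain ⟨v, hv⟩ := hu.exists_right_inv
      obtain ⟨v, rfl⟩ := Ideal.Quotient.mk_surjective v
      rw [← map_mul, ← map_one (Ideal.Quotient.mk (locI m s)), Ideal.Quotient.eq] at hv
      have h1 := locI_le m s hsm hv
      have := m.sub_mem (m.mul_mem_right v hr) h1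
      rw [sub_sub_cancel] at this
      exact hm.isPrime.one_notMem this)
    rw [Finset.prod_const, Finset.card_range, ← map_pow, Ideal.Quotient.eq_zero_iff_mem] at hn
    exact ⟨n, hn⟩
  · exact ⟨0, s, hsm, 1, by simp⟩

theorem mem_locI_smul (hR : IsAPD R) (m : Ideal R) [hm : m.IsMaximal] (t : R) (ht : t ≠ 0)
    {K : Type*} [AddCommGroup K] [Module R K] (k : K) :
    k ∈ locI m t • (⊤ : Submodule R K) ↔ ∃ u, u ∉ m ∧ ∃ k' : K, u • k = t • k' := by
  constructor
  · intro h
    refine Submodule.smul_induction_on h ?_ ?_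
    · rintro a ⟨u, hu, c, hc⟩ n _
      exact ⟨u, hu, c • n, by rw [smul_smul, smul_smul, hc]⟩
    · rintro x y ⟨u, hu, c, hc⟩ ⟨v, hv, d, hd⟩
      refine ⟨u * v, fun h => (hm.isPrime.mem_or_mem h).elim hu hv, v • c + u • d, ?_⟩
      rw [smul_add, mul_smul u v y, hd, mul_comm, mul_smul, hc, smul_add, smul_comm t v,
        smul_comm t u]
  · rintro ⟨u, hu, k', h⟩
    obtain ⟨v, hv⟩ := locI_inv hR m t ht u hu
    have : k = (v * t) • k' - (v * u - 1) • k := by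
      rw [sub_smul, mul_smul, mul_smul, h, one_smul]; abel
    rw [this]
    exact Submodule.sub_mem _ (Submodule.smul_mem_smul (Ideal.mul_mem_left _ _ (self_mem_locI m t))
      trivial) (Submodule.smul_mem_smul hv trivial)

open TensorProduct in
theorem one_tmul_eq_zero (I : Ideal R) {K : Type*} [AddCommGroup K] [Module R K] (k : K) :
    ((1 : R ⧸ I) ⊗ₜ[R] k = 0) ↔ k ∈ I • (⊤ : Submodule R K) := by
  rw [← (TensorProduct.quotTensorEquivQuotSMul K I).map_eq_zero_iff]
  have : TensorProduct.quotTensorEquivQuotSMul K I ((1 : R ⧸ I) ⊗ₜ[R] k) = Submodule.Quotient.mk k := by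
    have := TensorProduct.quotTensorEquivQuotSMul_mk_tmul I (1 : R) k
    rw [one_smul] at this
    exact this
  rw [this, Submodule.Quotient.mk_eq_zero]

open TensorProduct in
theorem one_tmul_surj (I : Ideal R) {K : Type*} [AddCommGroup K] [Module R K]
    (x : (R ⧸ I) ⊗[R] K) : ∃ k : K, (1 : R ⧸ I) ⊗ₜ[R] k = x := by
  induction x using TensorProduct.induction_on with
  | zero => exact ⟨0, by simp⟩
  | tmul a k =>
    obtain ⟨a, rfl⟩ := Ideal.Quotient.mk_surjective a
    refine ⟨a • k, ?_⟩
    rw [← TensorProduct.smul_tmul, Algebra.smul_def, mul_one]; rfl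
  | add x y hx hy =>
    obtain ⟨k, rfl⟩ := hx
    obtain ⟨l, rfl⟩ := hy
    exact ⟨k + l, by rw [TensorProduct.tmul_add]⟩

open TensorProduct in
theorem local_basis (hR : IsAPD R) (m : Ideal R) [hm : m.IsMaximal] (t : R) (ht : t ≠ 0)
    (htm : t ∈ m) {P₁ P₀ K : Type u} [AddCommGroup P₁] [Module R P₁] [AddCommGroup P₀]
    [Module R P₀] [AddCommGroup K] [Module R K] [Module.Projective R P₁] [Module.Projective R P₀]
    (i : P₁ →ₗ[R] P₀) (π : P₀ →ₗ[R] K) (hi : Function.Injective i)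
    (hπ : Function.Surjective π) (hex : Function.Exact i π)
    (htf : ∀ (s : R) (k : K), s ≠ 0 → s • k = 0 → k = 0) :
    ∃ (ι : Type u) (φ : (ι →₀ R) →ₗ[R] K),
      (∀ k, ∃ u, u ∉ m ∧ ∃ y k', u • k = φ y + t • k') ∧
      (∀ y k', φ y = t • k' → ∃ u, u ∉ m ∧ ∃ y', u • y = t • y') := by
  classical
  let I := locI m t
  have := locI_local hR m t ht htm
  have hfree : Module.Free (R ⧸ I) ((R ⧸ I) ⊗[R] K) := by
    refine free_of_pd_one (locI_perfect hR m t ht) (i.baseChange (R ⧸ I)) (π.baseChange (R ⧸ I))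
      ?_ ?_ ?_
    · rw [injective_iff_map_eq_zero]
      intro x hx
      obtain ⟨p, rfl⟩ := one_tmul_surj I x
      rw [LinearMap.baseChange_tmul, one_tmul_eq_zero, mem_locI_smul hR m t ht] at hx
      obtain ⟨u, hu, q, hq⟩ := hx
      have h1 : π q = 0 := by
        apply htf t _ ht
        rw [← map_smul, ← hq, map_smul, hex.apply_apply_eq_zero, smul_zero]
      obtain ⟨p', rfl⟩ := (hex q).mp h1
      rw [one_tmul_eq_zero, mem_locI_smul hR m t ht]
      exact ⟨u, hu, p', hi (by rw [map_smul, map_smul, hq])⟩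
    · exact LinearMap.lTensor_surjective _ hπ
    · exact lTensor_exact _ hex hπ
  let b := Module.Free.chooseBasis (R ⧸ I) ((R ⧸ I) ⊗[R] K)
  choose v hv using fun j => one_tmul_surj I (b j)
  have key : ∀ y : _ →₀ R, (1 : R ⧸ I) ⊗ₜ[R] (Finsupp.linearCombination R v y) =
      Finsupp.linearCombination (R ⧸ I) b (y.mapRange (Ideal.Quotient.mk I) (map_zero _)) := by
    intro y
    rw [Finsupp.linearCombination_apply, Finsupp.linearCombination_apply,
      Finsupp.sum_mapRange_index (by simp), Finsupp.sum, Finsupp.sum, TensorProduct.tmul_sum]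
    refine Finset.sum_congr rfl fun j _ => ?_
    rw [TensorProduct.tmul_smul, hv]
    rfl
  refine ⟨_, Finsupp.linearCombination R v, ?_, ?_⟩
  · intro k
    have hx := b.linearCombination_repr ((1 : R ⧸ I) ⊗ₜ[R] k)
    obtain ⟨y, hy⟩ := Finsupp.mapRange_surjective (Ideal.Quotient.mk I) (map_zero _)
      Ideal.Quotient.mk_surjective (b.repr ((1 : R ⧸ I) ⊗ₜ[R] k))
    rw [← hy, ← key] at hx
    have h2 : (1 : R ⧸ I) ⊗ₜ[R] (k - Finsupp.linearCombination R v y) = 0 := by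
      rw [TensorProduct.tmul_sub, hx, sub_self]
    rw [one_tmul_eq_zero, mem_locI_smul hR m t ht] at h2
    obtain ⟨u, hu, k', h⟩ := h2
    refine ⟨u, hu, u • y, k', ?_⟩
    rw [← h, map_smul, smul_sub]; abel
  · intro y k' h
    have h2 : (1 : R ⧸ I) ⊗ₜ[R] (Finsupp.linearCombination R v y) = 0 := by
      rw [one_tmul_eq_zero, mem_locI_smul hR m t ht]
      exact ⟨1, hm.isPrime.one_notMem, k', by rw [one_smul, h]⟩
    rw [key] at h2
    have h3 := linearIndependent_iff.mp b.linearIndependent _ h2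
    have h4 : ∀ j, y j ∈ I := fun j => by
      have := DFunLike.congr_fun h3 j
      exact Ideal.Quotient.eq_zero_iff_mem.mp (by simpa using this)
    have h5 : y ∈ I • (⊤ : Submodule R (_ →₀ R)) := by
      rw [← Finsupp.sum_single y]
      refine Submodule.sum_mem _ fun j _ => ?_
      have : Finsupp.single j (y j) = y j • Finsupp.single j (1 : R) := by simp
      show Finsupp.single j (y j) ∈ _
      rw [this]
      exact Submodule.smul_mem_smul (h4 j) trivial
    rwa [mem_locI_smul hR m t ht] at h5

theorem baer_of_div {V : Type*} [AddCommGroup V] [Module R V]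
    (htf : ∀ (s : R) (v : V), s ≠ 0 → s • v = 0 → v = 0)
    (hdiv : ∀ (s : R) (v : V), s ≠ 0 → ∃ w, s • w = v) : Module.Baer R V := by
  intro I g
  by_cases hI : I = ⊥
  · subst hI
    refine ⟨0, fun x hx => ?_⟩
    have hx0 : x = 0 := by simpa using hx
    subst hx0
    have : (⟨0, hx⟩ : (⊥ : Ideal R)) = 0 := rfl
    rw [this]; simp
  · obtain ⟨a, ha, ha0⟩ := Submodule.exists_mem_ne_zero_of_ne_bot hI
    obtain ⟨w, hw⟩ := hdiv a (g ⟨a, ha⟩) ha0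
    refine ⟨LinearMap.toSpanSingleton R V w, fun x hx => ?_⟩
    rw [LinearMap.toSpanSingleton_apply]
    apply sub_eq_zero.mp
    apply htf a _ ha0
    rw [smul_sub, smul_comm, hw, ← map_smul, ← map_smul, ← map_sub]
    convert map_zero g
    ext
    simp [mul_comm]

theorem local_ext (hR : IsAPD R) (m : Ideal R) [hm : m.IsMaximal] (t : R) (ht : t ≠ 0)
    (htm : t ∈ m) {P₁ P₀ K P : Type u} [AddCommGroup P₁] [Module R P₁] [AddCommGroup P₀]
    [Module R P₀] [AddCommGroup K] [Module R K] [Module.Projective R P₁] [Module.Projective R P₀]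
    [AddCommGroup P] [Module R P]
    (i : P₁ →ₗ[R] P₀) (π : P₀ →ₗ[R] K) (hi : Function.Injective i)
    (hπ : Function.Surjective π) (hex : Function.Exact i π)
    (htf : ∀ (s : R) (k : K), s ≠ 0 → s • k = 0 → k = 0)
    (j : K →ₗ[R] P) (hj : Function.Injective j)
    {V D : Type u} [AddCommGroup V] [Module R V] [AddCommGroup D] [Module R D]
    (hV : Module.Baer R V) (ρ : V →ₗ[R] D) (hρ : Function.Surjective ρ)
    (hD : ∀ u : m.primeCompl, IsUnit (algebraMap R (Module.End R D) u)) (f : K →ₗ[R] D) :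
    ∃ g : P →ₗ[R] D, g ∘ₗ j = f := by
  obtain ⟨ι, φ, h1, h2⟩ := local_basis hR m t ht htm i π hi hπ hex htf
  have hmul : ∀ {u v : R}, u ∉ m → v ∉ m → u * v ∉ m := fun hu hv h =>
    (hm.isPrime.mem_or_mem h).elim hu hv
  have cancel : ∀ (s : R) (k l : K), s ≠ 0 → s • k = s • l → k = l := fun s k l hs h =>
    sub_eq_zero.mp (htf s _ hs (by rw [smul_sub, h, sub_self]))
  have h1n : ∀ n k, ∃ u, u ∉ m ∧ ∃ y k', u • k = φ y + t ^ n • k' := by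
    intro n k
    induction n with
    | zero => exact ⟨1, hm.isPrime.one_notMem, 0, k, by simp⟩
    | succ n ih =>
      obtain ⟨u, hu, y, k', h⟩ := ih
      obtain ⟨u', hu', y', k'', h'⟩ := h1 k'
      refine ⟨u' * u, hmul hu' hu, u' • y + t ^ n • y', k'', ?_⟩
      rw [mul_smul, h, smul_add, smul_comm u', h', map_add, map_smul, map_smul, smul_add,
        smul_smul, pow_succ, add_assoc]
  have h2n : ∀ n y k', φ y = t ^ n • k' → ∃ u, u ∉ m ∧ ∃ y', u • y = t ^ n • y' := by
    intro n
    induction n with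
    | zero => exact fun y k' _ => ⟨1, hm.isPrime.one_notMem, y, by simp⟩
    | succ n ih =>
      intro y k h
      obtain ⟨u, hu, y', h'⟩ := ih y (t • k) (by rw [h, smul_smul, pow_succ])
      have h3 : φ y' = t • (u • k) := by
        apply cancel (t ^ n) _ _ (pow_ne_zero _ ht)
        rw [← map_smul, ← h', map_smul, h, smul_smul, smul_smul, smul_smul]
        congr 1; ring
      obtain ⟨u', hu', y'', h''⟩ := h2 _ _ h3
      refine ⟨u' * u, hmul hu' hu, y'', ?_⟩
      rw [mul_smul, h', smul_comm, h'', smul_smul, pow_succ]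
  have hdiv : ∀ (s : R) (k : K), s ≠ 0 → ∃ u, u ∉ m ∧ ∃ y k', u • k = φ y + s • k' := by
    intro s k hs
    obtain ⟨n, u, hu, c, hc⟩ := exists_pow hR m t htm s hs
    obtain ⟨u', hu', y, k', h⟩ := h1n n k
    refine ⟨u * u', hmul hu hu', u • y, c • k', ?_⟩
    rw [mul_smul, h, smul_add, map_smul, smul_smul, smul_smul, hc]
  have htf' : ∀ (s : R) (k : K) (y), s ≠ 0 → s • k = φ y → ∃ u, u ∉ m ∧ ∃ y', u • k = φ y' := by
    intro s k y hs h
    obtain ⟨n, u, hu, c, hc⟩ := exists_pow hR m t htm s hs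
    have h3 : φ (c • y) = t ^ n • (u • k) := by
      rw [map_smul, ← h, smul_smul, smul_smul, mul_comm c, ← hc, mul_comm]
    obtain ⟨u', hu', y', h'⟩ := h2n n _ _ h3
    refine ⟨u' * u, hmul hu' hu, y', ?_⟩
    apply cancel (t ^ n) _ _ (pow_ne_zero _ ht)
    rw [← map_smul φ, ← h', map_smul, h3, smul_smul, smul_smul, smul_smul]
    congr 1; ring
  have hinj : Function.Injective φ := by
    rw [injective_iff_map_eq_zero]
    intro y hy
    ext a
    by_contra hne
    have hne : y a ≠ 0 := hne
    obtain ⟨n, u, hu, c, hc⟩ := exists_pow hR m t htm (y a) hne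
    obtain ⟨u', hu', y', h'⟩ := h2n (n + 1) y 0 (by rw [hy, smul_zero])
    have h3 : u' * y a = t ^ (n + 1) * y' a := DFunLike.congr_fun h' a
    have h4 : u' * u = t * (y' a * c) := by
      apply mul_left_cancel₀ (pow_ne_zero n ht)
      linear_combination u' * hc + c * h3
    exact hmul hu' hu (h4 ▸ m.mul_mem_right _ htm)
  -- first correction
  obtain ⟨ψ, hψ⟩ := Module.projective_lifting_property ρ (f ∘ₗ φ) hρ
  obtain ⟨g₀, hg₀⟩ := hV.extension_property (j ∘ₗ φ) (hj.comp hinj) ψ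
  let d : K →ₗ[R] D := f - ρ ∘ₗ g₀ ∘ₗ j
  have hd : LinearMap.range φ ≤ LinearMap.ker d := by
    rintro _ ⟨y, rfl⟩
    have e1 : ρ (ψ y) = f (φ y) := LinearMap.congr_fun hψ y
    have e2 : g₀ (j (φ y)) = ψ y := LinearMap.congr_fun hg₀ y
    rw [LinearMap.mem_ker]
    show f (φ y) - ρ (g₀ (j (φ y))) = 0
    rw [e2, e1, sub_self]
  let N := LinearMap.range φ
  let d' : (K ⧸ N) →ₗ[R] D := N.liftQ d hd
  let W := LocalizedModule m.primeCompl (K ⧸ N)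
  let w : (K ⧸ N) →ₗ[R] W := LocalizedModule.mkLinearMap m.primeCompl (K ⧸ N)
  have hw : IsLocalizedModule m.primeCompl w := inferInstance
  let d'' : W →ₗ[R] D := IsLocalizedModule.lift m.primeCompl w d' hD
  have hd'' : ∀ x, d'' (w x) = d' x := fun x => IsLocalizedModule.lift_apply _ w d' hD x
  have hwinj : ∀ (u : m.primeCompl) (x : W), u.1 • x = 0 → x = 0 := by
    intro u x hx
    have := (Module.End.isUnit_iff _).mp (hw.map_units u)
    exact this.1 (by simpa using hx)
  have hW : Module.Baer R W := by
    apply baer_of_div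
    · intro s x hs hx
      obtain ⟨⟨k, u⟩, hk⟩ := hw.surj x
      obtain ⟨k, rfl⟩ := Submodule.mkQ_surjective _ k
      have hk : u.1 • x = w (N.mkQ k) := hk
      have h3 : w (N.mkQ (s • k)) = w 0 := by
        rw [map_smul, map_smul, ← hk, smul_comm, hx, smul_zero, map_zero]
      obtain ⟨v, hv⟩ := hw.exists_of_eq h3
      have hv : v.1 • N.mkQ (s • k) = 0 := by rw [smul_zero] at hv; exact hv
      rw [← map_smul] at hv
      obtain ⟨y, hy⟩ := (Submodule.Quotient.mk_eq_zero _).mp hv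
      obtain ⟨u', hu', y', h'⟩ := htf' s (v.1 • k) y hs (by rw [hy, smul_comm])
      apply hwinj u
      rw [hk]
      apply hwinj v
      apply hwinj ⟨u', hu'⟩
      show u' • v.1 • w (N.mkQ k) = 0
      rw [← map_smul, ← map_smul, ← map_smul, ← map_smul, h']
      have : N.mkQ (φ y') = 0 := (Submodule.Quotient.mk_eq_zero _).mpr ⟨y', rfl⟩
      rw [this, map_zero]
    · intro s x hs
      obtain ⟨⟨k, u⟩, hk⟩ := hw.surj x
      obtain ⟨k, rfl⟩ := Submodule.mkQ_surjective _ k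
      have hk : u.1 • x = w (N.mkQ k) := hk
      obtain ⟨u', hu', y, k', h⟩ := hdiv s k hs
      have hb := (Module.End.isUnit_iff _).mp (hw.map_units (⟨u', hu'⟩ * u))
      obtain ⟨z, hz⟩ := hb.2 (w (N.mkQ k'))
      have hz : (u' * u.1) • z = w (N.mkQ k') := hz
      refine ⟨z, ?_⟩
      apply sub_eq_zero.mp
      apply hwinj (⟨u', hu'⟩ * u)
      show (u' * u.1) • (s • z - x) = 0
      rw [smul_sub, smul_comm, hz, mul_smul, hk, ← map_smul, ← map_smul, ← map_smul, ← map_smul,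
        ← map_sub, ← map_sub, h]
      have : N.mkQ (s • k' - (φ y + s • k')) = 0 :=
        (Submodule.Quotient.mk_eq_zero _).mpr ⟨-y, by rw [map_neg]; abel⟩
      rw [this, map_zero]
  obtain ⟨g₁, hg₁⟩ := hW.extension_property j hj (w ∘ₗ N.mkQ)
  refine ⟨ρ ∘ₗ g₀ + d'' ∘ₗ g₁, ?_⟩
  ext k
  have e1 : g₁ (j k) = w (N.mkQ k) := LinearMap.congr_fun hg₁ k
  show ρ (g₀ (j k)) + d'' (g₁ (j k)) = f k
  rw [e1, hd'']
  show ρ (g₀ (j k)) + (f k - ρ (g₀ (j k))) = f k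
  abel

/-- the localization at `m` of `F` inside `V` -/
def locF (m : Ideal R) [hm : m.IsMaximal] {V : Type*} [AddCommGroup V] [Module R V]
    (F : Submodule R V) : Submodule R V where
  carrier := {v | ∃ u, u ∉ m ∧ u • v ∈ F}
  zero_mem' := ⟨1, hm.isPrime.one_notMem, by simp⟩
  add_mem' := by
    rintro a b ⟨u, hu, ha⟩ ⟨v, hv, hb⟩
    refine ⟨u * v, fun h => (hm.isPrime.mem_or_mem h).elim hu hv, ?_⟩
    rw [smul_add]
    refine F.add_mem ?_ ?_
    · rw [mul_comm, mul_smul]; exact F.smul_mem _ ha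
    · rw [mul_smul]; exact F.smul_mem _ hb
  smul_mem' := by
    rintro r a ⟨u, hu, ha⟩
    exact ⟨u, hu, by rw [smul_comm]; exact F.smul_mem _ ha⟩

theorem glue (hR : IsAPD R) {V : Type u} [AddCommGroup V] [Module R V] (F : Submodule R V)
    (htors : ∀ v : V, ∃ s : R, s ≠ 0 ∧ s • v ∈ F) (t : R) (ht : t ≠ 0)
    (y : ∀ m : {m : Ideal R // m.IsMaximal}, V)
    (hy : ∀ m : {m : Ideal R // m.IsMaximal}, haveI := m.2; t • y m ∈ locF m.1 F) :
    ∃ z : V, ∀ m : {m : Ideal R // m.IsMaximal}, haveI := m.2; z - y m ∈ locF m.1 F := by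
  classical
  have H : ∀ m : {m : Ideal R // m.IsMaximal}, ∃ z : V,
      (haveI := m.2; z - y m ∈ locF m.1 F) ∧
      ∀ m' : {m : Ideal R // m.IsMaximal}, m' ≠ m → (haveI := m'.2; z ∈ locF m'.1 F) := by
    rintro ⟨m, hm⟩
    obtain ⟨s, hs, hsy⟩ := htors (y ⟨m, hm⟩)
    obtain ⟨e, ⟨u, hu, c, hc⟩, h2⟩ := exists_e hR m s hs
    refine ⟨e • y ⟨m, hm⟩, ⟨u, hu, ?_⟩, ?_⟩
    · have : u • (e • y ⟨m, hm⟩ - y ⟨m, hm⟩) = c • s • y ⟨m, hm⟩ := by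
        rw [smul_smul c s, mul_comm c, ← hc, mul_smul, sub_smul, one_smul]
      rw [this]
      exact F.smul_mem _ hsy
    · rintro ⟨m', hm'⟩ hne
      obtain ⟨u', hu', c', hc'⟩ := h2 m' hm' (fun h => hne (Subtype.ext h))
      refine ⟨u', hu', ?_⟩
      rw [smul_smul, hc', mul_comm, mul_smul]
      exact F.smul_mem _ hsy
  choose z hz hz' using H
  have hfin : {m : {m : Ideal R // m.IsMaximal} | t ∈ m.1}.Finite := by
    refine Set.Finite.of_finite_image (f := Subtype.val) ((finite_max hR t ht).subset ?_)
      Subtype.val_injective.injOn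
    rintro _ ⟨m, hm, rfl⟩
    exact ⟨m.2, hm⟩
  refine ⟨∑ m ∈ hfin.toFinset, z m, fun m => ?_⟩
  have := m.2
  show _ ∈ locF m.1 F
  by_cases htm : t ∈ m.1
  · rw [← Finset.add_sum_erase _ _ (hfin.mem_toFinset.mpr htm), add_sub_right_comm]
    refine Submodule.add_mem _ (hz m) (Submodule.sum_mem _ fun m' hm' => ?_)
    exact hz' m' m (Finset.ne_of_mem_erase hm').symm
  · refine Submodule.sub_mem _ (Submodule.sum_mem _ fun m' hm' => ?_) ?_
    · refine hz' m' m ?_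
      rintro rfl
      exact htm (hfin.mem_toFinset.mp hm')
    · obtain ⟨u, hu, h⟩ := hy m
      exact ⟨u * t, fun h => (m.2.isPrime.mem_or_mem h).elim hu htm, by rwa [mul_smul]⟩

theorem mem_of_locF {V : Type*} [AddCommGroup V] [Module R V] (F : Submodule R V) (v : V)
    (h : ∀ m : {m : Ideal R // m.IsMaximal}, haveI := m.2; v ∈ locF m.1 F) : v ∈ F := by
  let I : Ideal R := F.comap (LinearMap.toSpanSingleton R V v)
  have hI : I = ⊤ := by
    by_contra hne
    obtain ⟨m, hm, hle⟩ := Ideal.exists_le_maximal _ hne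
    obtain ⟨u, hu, h⟩ := h ⟨m, hm⟩
    exact hu (hle h)
  have : (1 : R) ∈ I := by rw [hI]; trivial
  simpa [I] using this

theorem global_ext (hR : IsAPD R) (hQ : ¬ IsField R)
    {P₁ P₀ K P : Type u} [AddCommGroup P₁] [Module R P₁] [AddCommGroup P₀]
    [Module R P₀] [AddCommGroup K] [Module R K] [Module.Projective R P₁] [Module.Projective R P₀]
    [AddCommGroup P] [Module R P]
    (i : P₁ →ₗ[R] P₀) (π : P₀ →ₗ[R] K) (hi : Function.Injective i)
    (hπ : Function.Surjective π) (hex : Function.Exact i π)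
    (htf : ∀ (s : R) (k : K), s ≠ 0 → s • k = 0 → k = 0)
    (j : K →ₗ[R] P) (hj : Function.Injective j)
    (hjt : ∀ p : P, ∃ s : R, s ≠ 0 ∧ ∃ k, s • p = j k)
    {V : Type u} [AddCommGroup V] [Module R V]
    (hdivV : ∀ (s : R) (v : V), s ≠ 0 → ∃ w, s • w = v)
    (hV : Module.Baer R V) (F : Submodule R V) (htors : ∀ v : V, ∃ s : R, s ≠ 0 ∧ s • v ∈ F)
    (f : K →ₗ[R] V ⧸ F) :
    ∃ g : P →ₗ[R] V ⧸ F, g ∘ₗ j = f := by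
  let S := {m : Ideal R // m.IsMaximal}
  let Fm : S → Submodule R V := fun m => haveI := m.2; locF m.1 F
  have hFm : ∀ m, F ≤ Fm m := fun m v hv => ⟨1, m.2.isPrime.one_notMem, by rwa [one_smul]⟩
  let a : ∀ m, (V ⧸ F) →ₗ[R] (V ⧸ Fm m) := fun m => Submodule.factor (hFm m)
  have ha : ∀ m v, a m (F.mkQ v) = (Fm m).mkQ v := fun m v => rfl
  have hext : ∀ m, ∃ g : P →ₗ[R] V ⧸ Fm m, g ∘ₗ j = a m ∘ₗ f := by
    intro m
    have := m.2
    have hne : m.1 ≠ ⊥ := Ring.ne_bot_of_isMaximal_of_not_isField m.2 hQ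
    obtain ⟨t, htm, ht⟩ := Submodule.exists_mem_ne_zero_of_ne_bot hne
    refine local_ext hR m.1 t ht htm i π hi hπ hex htf j hj hV (Fm m).mkQ
      (Submodule.mkQ_surjective _) ?_ _
    intro u
    rw [Module.End.isUnit_iff]
    constructor
    · rw [injective_iff_map_eq_zero]
      intro x hx
      obtain ⟨x, rfl⟩ := Submodule.mkQ_surjective _ x
      have hx : (Fm m).mkQ (u.1 • x) = 0 := hx
      obtain ⟨v, hv, h⟩ := (Submodule.Quotient.mk_eq_zero _).mp hx
      refine (Submodule.Quotient.mk_eq_zero _).mpr ⟨v * u.1, ?_, by rwa [mul_smul]⟩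
      exact fun h => (m.2.isPrime.mem_or_mem h).elim hv u.2
    · intro x
      obtain ⟨x, rfl⟩ := Submodule.mkQ_surjective _ x
      obtain ⟨w, hw⟩ := hdivV u.1 x (by
        intro h0
        exact u.2 (h0 ▸ m.1.zero_mem))
      refine ⟨(Fm m).mkQ w, ?_⟩
      show u.1 • (Fm m).mkQ w = _
      rw [← map_smul, hw]
  choose g hg using hext
  have hg' : ∀ m k, g m (j k) = a m (f k) := fun m k => LinearMap.congr_fun (hg m) k
  let A : (V ⧸ F) →ₗ[R] (∀ m, V ⧸ Fm m) := LinearMap.pi a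
  let G : P →ₗ[R] (∀ m, V ⧸ Fm m) := LinearMap.pi g
  have hA : Function.Injective A := by
    rw [injective_iff_map_eq_zero]
    intro x hx
    obtain ⟨x, rfl⟩ := Submodule.mkQ_surjective _ x
    refine (Submodule.Quotient.mk_eq_zero _).mpr (mem_of_locF F x fun m => ?_)
    have : a m (F.mkQ x) = 0 := congrFun hx m
    rw [ha] at this
    exact (Submodule.Quotient.mk_eq_zero _).mp this
  have hrange : ∀ p, G p ∈ LinearMap.range A := by
    intro p
    obtain ⟨s, hs, k, hk⟩ := hjt p
    obtain ⟨v, hv⟩ := Submodule.mkQ_surjective _ (f k)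
    obtain ⟨s', hs', hv'⟩ := htors v
    choose y hy using fun m => Submodule.mkQ_surjective (Fm m) (g m p)
    obtain ⟨z, hz⟩ := glue hR F htors (s' * s) (mul_ne_zero hs' hs) y (by
      intro m
      refine (Submodule.Quotient.mk_eq_zero (Fm m)).mp ?_
      show (Fm m).mkQ ((s' * s) • y m) = 0
      rw [map_smul, hy, mul_smul, ← map_smul, hk, hg', ← hv, ← map_smul, ← map_smul, ha]
      exact (Submodule.Quotient.mk_eq_zero (Fm m)).mpr (hFm m hv'))
    refine ⟨F.mkQ z, ?_⟩
    funext m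
    show a m (F.mkQ z) = g m p
    rw [ha, ← hy m]
    exact (Submodule.Quotient.eq _).mpr (hz m)
  let E := LinearEquiv.ofInjective A hA
  refine ⟨E.symm.toLinearMap ∘ₗ G.codRestrict _ hrange, ?_⟩
  ext k
  apply hA
  have : A (E.symm (G.codRestrict _ hrange (j k))) = G (j k) := by
    have := congrArg Subtype.val (E.apply_symm_apply (G.codRestrict _ hrange (j k)))
    exact this
  show A (E.symm (G.codRestrict _ hrange (j k))) = _
  rw [this]
  funext m
  exact hg' m k

theorem proj_tf {P : Type*} [AddCommGroup P] [Module R P] [Module.Projective R P] (s : R) (p : P)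
    (hs : s ≠ 0) (h : s • p = 0) : p = 0 := by
  obtain ⟨σ, hσ⟩ := Module.projective_def'.mp (inferInstance : Module.Projective R P)
  have h1 : Finsupp.linearCombination R id (σ p) = p := LinearMap.congr_fun hσ p
  have h2 : σ p = 0 := by
    ext q
    have : s • σ p = 0 := by rw [← map_smul, h, map_zero]
    have := DFunLike.congr_fun this q
    simpa [hs] using this
  rw [← h1, h2, map_zero]

theorem core (hR : IsAPD R) (hQ : ¬ IsField R)
    {P₁ P₀ K P : Type u} [AddCommGroup P₁] [Module R P₁] [AddCommGroup P₀]
    [Module R P₀] [AddCommGroup K] [Module R K] [Module.Projective R P₁] [Module.Projective R P₀]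
    [AddCommGroup P] [Module R P] [Module.Projective R P]
    (i : P₁ →ₗ[R] P₀) (π : P₀ →ₗ[R] K) (hi : Function.Injective i)
    (hπ : Function.Surjective π) (hex : Function.Exact i π)
    (j : K →ₗ[R] P) (hj : Function.Injective j)
    (hjt : ∀ p : P, ∃ s : R, s ≠ 0 ∧ ∃ k, s • p = j k) : Module.Projective R K := by
  have htf : ∀ (s : R) (k : K), s ≠ 0 → s • k = 0 → k = 0 := fun s k hs h =>
    hj (by rw [map_zero]; exact proj_tf s _ hs (by rw [← map_smul, h, map_zero]))
  let V := LocalizedModule (nonZeroDivisors R) P₁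
  let w : P₁ →ₗ[R] V := LocalizedModule.mkLinearMap (nonZeroDivisors R) P₁
  have hw : IsLocalizedModule (nonZeroDivisors R) w := inferInstance
  have hbij : ∀ s : R, s ≠ 0 → Function.Bijective (fun v : V => s • v) := fun s hs =>
    (Module.End.isUnit_iff _).mp (hw.map_units ⟨s, mem_nonZeroDivisors_of_ne_zero hs⟩)
  have hdiv : ∀ (s : R) (v : V), s ≠ 0 → ∃ w, s • w = v := fun s v hs => (hbij s hs).2 v
  have hV : Module.Baer R V := baer_of_div (fun s v hs h => (hbij s hs).1 (by simpa using h)) hdiv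
  have hwinj : Function.Injective w := by
    rw [injective_iff_map_eq_zero]
    intro p hp
    obtain ⟨c, hc⟩ := hw.exists_of_eq (hp.trans (map_zero w).symm)
    rw [smul_zero] at hc
    exact proj_tf c.1 p (nonZeroDivisors.ne_zero c.2) hc
  let F := LinearMap.range w
  have htors : ∀ v : V, ∃ s : R, s ≠ 0 ∧ s • v ∈ F := by
    intro v
    obtain ⟨⟨p, s⟩, h⟩ := hw.surj v
    exact ⟨s.1, nonZeroDivisors.ne_zero s.2, p, h.symm⟩
  obtain ⟨g₀, hg₀⟩ := hV.extension_property i hi w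
  have hg₀' : ∀ p, g₀ (i p) = w p := fun p => LinearMap.congr_fun hg₀ p
  have hker : LinearMap.ker π ≤ LinearMap.ker (F.mkQ ∘ₗ g₀) := by
    intro x hx
    obtain ⟨p, rfl⟩ := (hex x).mp hx
    rw [LinearMap.mem_ker, LinearMap.comp_apply, hg₀']
    exact (Submodule.Quotient.mk_eq_zero _).mpr ⟨p, rfl⟩
  let e := π.quotKerEquivOfSurjective hπ
  let f : K →ₗ[R] V ⧸ F := (LinearMap.ker π).liftQ _ hker ∘ₗ e.symm.toLinearMap
  have hf : ∀ x, f (π x) = F.mkQ (g₀ x) := by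
    intro x
    have : e.symm (π x) = (LinearMap.ker π).mkQ x := by
      rw [LinearEquiv.symm_apply_eq]; rfl
    show (LinearMap.ker π).liftQ _ hker (e.symm (π x)) = _
    rw [this]; rfl
  obtain ⟨g, hg⟩ := global_ext hR hQ i π hi hπ hex htf j hj hjt hdiv hV F htors f
  obtain ⟨l, hl⟩ := Module.projective_lifting_property F.mkQ g (Submodule.mkQ_surjective _)
  let r : P₀ →ₗ[R] V := g₀ - l ∘ₗ j ∘ₗ π
  have hr : ∀ x, r x ∈ F := by
    intro x
    refine (Submodule.Quotient.mk_eq_zero F).mp ?_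
    show F.mkQ (g₀ x - l (j (π x))) = 0
    have e1 : F.mkQ (l (j (π x))) = g (j (π x)) := LinearMap.congr_fun hl _
    have e2 : g (j (π x)) = f (π x) := LinearMap.congr_fun hg _
    rw [map_sub, e1, e2, hf, sub_self]
  let E := LinearEquiv.ofInjective w hwinj
  let ret : P₀ →ₗ[R] P₁ := E.symm.toLinearMap ∘ₗ r.codRestrict F hr
  have hret : ∀ p, ret (i p) = p := by
    intro p
    show E.symm (r.codRestrict F hr (i p)) = p
    rw [LinearEquiv.symm_apply_eq]
    apply Subtype.ext
    show g₀ (i p) - l (j (π (i p))) = w p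
    rw [hg₀', hex.apply_apply_eq_zero, map_zero, map_zero, sub_zero]
  -- K is a summand of P₀
  have hk2 : LinearMap.ker π ≤ LinearMap.ker (LinearMap.id - i ∘ₗ ret) := by
    intro x hx
    obtain ⟨p, rfl⟩ := (hex x).mp hx
    simp [hret]
  let sec : K →ₗ[R] P₀ := (LinearMap.ker π).liftQ _ hk2 ∘ₗ e.symm.toLinearMap
  refine Module.Projective.of_split sec π ?_
  ext k
  obtain ⟨x, rfl⟩ := hπ k
  have : e.symm (π x) = (LinearMap.ker π).mkQ x := by
    rw [LinearEquiv.symm_apply_eq]; rfl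
  show π ((LinearMap.ker π).liftQ _ hk2 (e.symm (π x))) = π x
  rw [this]
  show π (x - i (ret x)) = π x
  rw [map_sub, hex.apply_apply_eq_zero, sub_zero]

theorem core' (hR : IsAPD R) (hQ : ¬ IsField R)
    {P₁ P₀ K P M : Type u} [AddCommGroup P₁] [Module R P₁] [AddCommGroup P₀]
    [Module R P₀] [AddCommGroup K] [Module R K] [Module.Projective R P₁] [Module.Projective R P₀]
    [AddCommGroup P] [Module R P] [Module.Projective R P] [AddCommGroup M] [Module R M]
    (i : P₁ →ₗ[R] P₀) (π : P₀ →ₗ[R] K) (hi : Function.Injective i)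
    (hπ : Function.Surjective π) (hex : Function.Exact i π)
    (j : K →ₗ[R] P) (hj : Function.Injective j) (q : P →ₗ[R] M) (hq : Function.Surjective q)
    (hjq : Function.Exact j q) : Module.Projective R K := by
  obtain ⟨s, hs, hmax⟩ := exists_maximal_linearIndepOn R (fun x : M => x)
  have hs : LinearIndependent R (fun x : s => (x : M)) := hs
  let G := s →₀ R
  let b : G →ₗ[R] M := Finsupp.linearCombination R (fun x : s => (x : M))
  have hb : Function.Injective b := hs
  obtain ⟨γ, hγ⟩ := Module.projective_lifting_property q b hq
  have hγ' : ∀ g, q (γ g) = b g := fun g => LinearMap.congr_fun hγ g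
  have hKG : Module.Projective R (K × G) := by
    refine core hR hQ (P₁ := P₁) (P₀ := P₀ × G) (P := P) (LinearMap.inl R P₀ G ∘ₗ i)
      (π.prodMap LinearMap.id) ?_ ?_ ?_ (j.coprod γ) ?_ ?_
    · exact LinearMap.inl_injective.comp hi
    · rintro ⟨k, g⟩
      obtain ⟨x, rfl⟩ := hπ k
      exact ⟨(x, g), rfl⟩
    · rintro ⟨x, g⟩
      constructor
      · intro h
        have h1 : π x = 0 := congrArg Prod.fst h
        have h2 : g = 0 := congrArg Prod.snd h
        obtain ⟨p, rfl⟩ := (hex x).mp h1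
        exact ⟨p, by rw [h2]; rfl⟩
      · rintro ⟨p, hp⟩
        have h1 : i p = x := congrArg Prod.fst hp
        have h2 : 0 = g := congrArg Prod.snd hp
        subst h1 h2
        show (π (i p), (0 : G)) = 0
        rw [hex.apply_apply_eq_zero]; rfl
    · rw [injective_iff_map_eq_zero]
      rintro ⟨k, g⟩ h
      have h : j k + γ g = 0 := h
      have h1 : b g = 0 := by
        have := congrArg q h
        rwa [map_add, hjq.apply_apply_eq_zero, zero_add, hγ', map_zero] at this
      have hg : g = 0 := hb (by rw [h1, map_zero])
      subst hg
      rw [map_zero, add_zero] at h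
      have hk : k = 0 := hj (by rw [h, map_zero])
      subst hk
      rfl
    · intro p
      have H : ∃ a : R, a ≠ 0 ∧ a • q p ∈ LinearMap.range b := by
        by_cases hp : q p ∈ s
        · exact ⟨1, one_ne_zero, Finsupp.single ⟨q p, hp⟩ 1, by
            rw [one_smul]
            exact (Finsupp.linearCombination_single _ _ _).trans (one_smul _ _)⟩
        · obtain ⟨a, ha, h⟩ := hmax _ hp
          refine ⟨a, ha, ?_⟩
          rw [Finsupp.range_linearCombination]
          simpa using h
      obtain ⟨a, ha, g, hg⟩ := H
      have : q (a • p - γ g) = 0 := by rw [map_sub, map_smul, hγ', hg, sub_self]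
      obtain ⟨k, hk⟩ := (hjq _).mp this
      refine ⟨a, ha, (k, g), ?_⟩
      show _ = j k + γ g
      rw [hk]; abel
  exact Module.Projective.of_split (LinearMap.inl R K G) (LinearMap.fst R K G) (by ext; simp)

theorem step (hR : IsAPD R) (hQ : ¬ IsField R) (M P P₀ : ModuleCat.{u} R) (f : P ⟶ M) [Epi f]
    (hP : Projective P) (g : P₀ ⟶ kernel f) [Epi g] (hP₀ : Projective P₀)
    (hk : Projective (kernel g)) : Projective (kernel f) := by
  have h1 := (IsProjective.iff_projective (R := R) P).mpr hP
  have h2 := (IsProjective.iff_projective (R := R) P₀).mpr hP₀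
  have h3 := (IsProjective.iff_projective (R := R) (kernel g : ModuleCat.{u} R)).mpr hk
  have hS : ∀ {A B : ModuleCat.{u} R} (h : A ⟶ B), Function.Exact (kernel.ι h).hom h.hom :=
    fun h => (ShortComplex.ShortExact.moduleCat_exact_iff_function_exact
      (ShortComplex.mk (kernel.ι h) h (kernel.condition h))).mp
      (ShortComplex.exact_of_f_is_kernel _ (kernelIsKernel h))
  refine (IsProjective.iff_projective (R := R) (kernel f : ModuleCat.{u} R)).mp ?_
  exact core' hR hQ (kernel.ι g).hom g.hom ((ModuleCat.mono_iff_injective _).mp inferInstance)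
    ((ModuleCat.epi_iff_surjective g).mp inferInstance) (hS g) (kernel.ι f).hom
    ((ModuleCat.mono_iff_injective _).mp inferInstance) f.hom
    ((ModuleCat.epi_iff_surjective f).mp inferInstance) (hS f)

theorem main (hR : IsAPD R) (hQ : ¬ IsField R) (n : ℕ) :
    ∀ M : ModuleCat.{u} R, ProjDimLE R n M → ProjDimLE R 1 M := by
  induction n with
  | zero =>
    intro M hM
    refine ⟨M, 𝟙 M, inferInstance, hM, ?_⟩
    exact Projective.of_iso (isZero_kernel_of_mono (𝟙 M)).isoZero.symm inferInstance
  | succ n ih =>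
    rintro M ⟨P, f, hf, hP, hk⟩
    obtain ⟨P₀, g, hg, hP₀, hk'⟩ := ih _ hk
    exact ⟨P, f, hf, hP, step hR hQ M P P₀ f hP g hP₀ hk'⟩

end

end APDProof

/-- Over an almost perfect domain that is not a field, any module of finite projective
dimension has projective dimension at most `1`. -/
theorem projDimLE_one_of_finite (R : Type u) [CommRing R] [IsDomain R]
    (hR : IsAPD R) (hQ : ¬ IsField R) (M : ModuleCat.{u} R)
    (h : ∃ n : ℕ, ProjDimLE R n M) : ProjDimLE R 1 M := by
  obtain ⟨n, hn⟩ := h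
  exact APDProof.main hR hQ n M hn
end

section
/- An integral domain R is Dedekind if and only if R is an almost perfect domain of finite global dimension, if and only if R is an almost perfect domain of global dimension at most one. -/
universe u

open CategoryTheory Limits

/-- Dual basis expansion. -/
theorem dualBasis_aux {S : Type*} [CommRing S] {N : Type*} [AddCommGroup N] [Module S N]
    [Module.Projective S N] :
    ∃ s : N → Module.Dual S N, ∀ x : N, ∃ t : Finset N, x = ∑ i ∈ t, s i x • i := by
  obtain ⟨s, hs⟩ := Module.projective_def'.mp ‹Module.Projective S N›
  refine ⟨fun i => Finsupp.lapply i ∘ₗ s, fun x => ⟨(s x).support, ?_⟩⟩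
  have := LinearMap.congr_fun hs x
  simp only [LinearMap.comp_apply, LinearMap.id_apply, Finsupp.linearCombination_apply,
    Finsupp.sum] at this
  exact this.symm

/-- Nakayama type lemma for projective modules. -/
theorem proj_nak {S : Type*} [CommRing S] {N : Type*} [AddCommGroup N] [Module S N]
    [Module.Projective S N] (m : Ideal S) (φ : N →ₗ[S] N)
    (hφ : ∀ (g : Module.Dual S N) (y : N), g (φ y) ∈ m) (n : N) (d d' : S)
    (hd : φ n = d • n) (hd' : 1 - d' * d ∈ m) : ∃ c : S, c - 1 ∈ m ∧ c • n = 0 := by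
  obtain ⟨s, hs⟩ := dualBasis_aux (S := S) (N := N)
  obtain ⟨t, ht⟩ := hs n
  let D : Ideal S := Ideal.span ((fun i => s i n) '' (t : Set N))
  have hfg : D.FG := by
    classical
    exact ⟨t.image (fun i => s i n), by simp [D, Finset.coe_image, Ideal.span]⟩
  have hle : D ≤ m • D := by
    refine Ideal.span_le.mpr ?_
    rintro _ ⟨j, hj, rfl⟩
    have h1 : s j n = (1 - d' * d) * s j n + d' * (d * s j n) := by ring
    have h2 : d * s j n = ∑ i ∈ t, s i n * s j (φ i) := by
      have : d * s j n = s j (φ n) := by rw [hd, map_smul, smul_eq_mul]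
      rw [this]
      conv_lhs => rw [ht]
      simp [map_sum]
    have hjD : s j n ∈ D := Ideal.subset_span ⟨j, hj, rfl⟩
    change s j n ∈ m • D
    rw [h1, h2]
    refine add_mem (Submodule.smul_mem_smul hd' hjD) (Ideal.mul_mem_left _ _ (sum_mem ?_))
    intro i hi
    rw [mul_comm]
    exact Submodule.smul_mem_smul (hφ _ _) (Ideal.subset_span ⟨i, hi, rfl⟩)
  obtain ⟨c, hc, hc'⟩ :=
    Submodule.exists_sub_one_mem_and_smul_eq_zero_of_fg_of_le_smul m D hfg hle
  refine ⟨c, hc, ?_⟩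
  conv_lhs => rw [ht]
  rw [Finset.smul_sum]
  refine Finset.sum_eq_zero fun i hi => ?_
  rw [← smul_assoc, hc' _ (Ideal.subset_span ⟨i, hi, rfl⟩), zero_smul]

/-- Over a perfect ring, `J M = M` implies `M = 0`. -/
theorem perfect_nak {S : Type u} [CommRing S] (hS : IsPerfectRing S) (M : Type u)
    [AddCommGroup M] [Module S M] (h : (⊤ : Submodule S M) ≤ (Ring.jacobson S : Ideal S) • ⊤) :
    Subsingleton M := by
  obtain ⟨P, _, _, f, hP, hf, hsup⟩ := hS M inferInstance inferInstance
  have h1 : (Ring.jacobson S : Ideal S) • (⊤ : Submodule S P) = ⊤ := by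
    apply hsup
    rw [eq_top_iff]
    intro x _
    have hx : f x ∈ (Ring.jacobson S : Ideal S) • (⊤ : Submodule S M) := h trivial
    have : (⊤ : Submodule S M) = Submodule.map f ⊤ := by
      rw [Submodule.map_top, LinearMap.range_eq_top.mpr hf]
    rw [this, ← Submodule.map_smul''] at hx
    obtain ⟨y, hy, hxy⟩ := hx
    rw [← sub_add_cancel x y, add_comm]
    exact Submodule.add_mem_sup hy (by simp [hxy])
  have hP0 : ∀ x : P, x = 0 := by
    intro x
    obtain ⟨c, hc, hc'⟩ := proj_nak (Ring.jacobson S : Ideal S) (LinearMap.id : P →ₗ[S] P)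
      (by
        intro g y
        have hy : y ∈ (Ring.jacobson S : Ideal S) • (⊤ : Submodule S P) := by
          rw [h1]; trivial
        have := Submodule.mem_map_of_mem (f := g) hy
        rw [Submodule.map_smul''] at this
        refine (Submodule.smul_le.mpr fun r hr n _ => ?_ :
          (Ring.jacobson S : Ideal S) • Submodule.map g ⊤ ≤ (Ring.jacobson S : Ideal S)) this
        exact Ideal.mul_mem_right _ _ hr) x 1 1 (by simp) (by simp)
    have hu : IsUnit c := by
      rw [← Ideal.jacobson_bot] at hc
      have := Ideal.mem_jacobson_bot.mp hc 1
      simpa using this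
    exact (hu.smul_eq_zero).mp hc'
  refine ⟨fun a b => ?_⟩
  obtain ⟨a, rfl⟩ := hf a
  obtain ⟨b, rfl⟩ := hf b
  rw [hP0 a, hP0 b]

/-- T-nilpotency of the Jacobson radical. -/
theorem perfect_tnilp {S : Type u} [CommRing S] (hS : IsPerfectRing S) (j : ℕ → S)
    (hj : ∀ n, j n ∈ (Ring.jacobson S : Ideal S)) : ∃ n, ∏ i ∈ Finset.range n, j i = 0 := by
  by_contra! hne
  let Z : Submodule S (ℕ → S) :=
    { carrier := {x | ∃ N, ∀ k ≥ N, x k = 0}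
      add_mem' := by
        rintro a b ⟨N, hN⟩ ⟨N', hN'⟩
        exact ⟨max N N', fun k hk => by
          simp [hN k (le_trans (le_max_left _ _) hk), hN' k (le_trans (le_max_right _ _) hk)]⟩
      zero_mem' := ⟨0, fun _ _ => rfl⟩
      smul_mem' := by
        rintro c x ⟨N, hN⟩
        exact ⟨N, fun k hk => by simp [hN k hk]⟩ }
  let y : ℕ → (ℕ → S) ⧸ Z := fun n => Z.mkQ (fun k => ∏ i ∈ Finset.Ico n k, j i)
  have hy : ∀ n, y n = j n • y (n + 1) := by
    intro n
    rw [← map_smul, ← sub_eq_zero, ← map_sub]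
    refine (Submodule.Quotient.mk_eq_zero Z).mpr ⟨n + 1, fun k hk => ?_⟩
    simp [Finset.prod_eq_prod_Ico_succ_bot (show n < k by omega)]
  let M := Submodule.span S (Set.range y)
  have hM : Subsingleton M := by
    apply perfect_nak hS
    rintro ⟨x, hx⟩ -
    have key : M ≤ Submodule.map M.subtype
        ((Ring.jacobson S : Ideal S) • (⊤ : Submodule S M)) := by
      refine Submodule.span_le.mpr ?_
      rintro _ ⟨n, rfl⟩
      rw [hy n]
      exact ⟨j n • ⟨y (n + 1), Submodule.subset_span ⟨_, rfl⟩⟩,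
        Submodule.smul_mem_smul (hj n) trivial, rfl⟩
    obtain ⟨z, hz, hzx⟩ := key hx
    have : z = ⟨x, hx⟩ := Subtype.ext hzx
    exact this ▸ hz
  have h0 : y 0 = 0 := by
    have := Subsingleton.elim (⟨y 0, Submodule.subset_span ⟨0, rfl⟩⟩ : M) 0
    exact congrArg Subtype.val this
  obtain ⟨N, hN⟩ := (Submodule.Quotient.mk_eq_zero Z).mp h0
  have : ∏ i ∈ Finset.Ico 0 N, j i = 0 := hN N le_rfl
  rw [← Finset.range_eq_Ico] at this
  exact hne N this

theorem perfect_socle {S : Type u} [CommRing S] (hS : IsPerfectRing S) {K : Type*}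
    [AddCommGroup K] [Module S K] (x₀ : K) (hx₀ : x₀ ≠ 0) :
    ∃ s : S, (∃ x : K, s • x ≠ 0) ∧
      ∀ j ∈ (Ring.jacobson S : Ideal S), ∀ x : K, (s * j) • x = 0 := by
  by_contra! hcon
  let T := {s : S // ∃ x : K, s • x ≠ 0}
  have step : ∀ s : T, ∃ j ∈ (Ring.jacobson S : Ideal S), ∃ x : K, (s.1 * j) • x ≠ 0 :=
    fun s => hcon s.1 s.2
  choose jj hjj hjx using step
  let q : ℕ → T := fun n => Nat.rec ⟨1, x₀, by simpa using hx₀⟩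
    (fun _ s => ⟨s.1 * jj s, hjx s⟩) n
  have hq : ∀ n, (q n).1 = ∏ i ∈ Finset.range n, jj (q i) := by
    intro n
    induction n with
    | zero => rfl
    | succ n ih => rw [Finset.prod_range_succ, ← ih]
  obtain ⟨n, hn⟩ := perfect_tnilp hS (fun i => jj (q i)) (fun i => hjj _)
  obtain ⟨x, hx⟩ := (q n).2
  rw [hq n, hn, zero_smul] at hx
  exact hx rfl

/-- Over a perfect ring, modules of projective dimension at most one are projective. -/
theorem perfect_pd_one {S : Type u} [CommRing S] (hS : IsPerfectRing S) {P M : Type u}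
    [AddCommGroup P] [Module S P] [AddCommGroup M] [Module S M]
    [Module.Projective S P] (f : P →ₗ[S] M) (hf : Function.Surjective f)
    (hK : Module.Projective S (LinearMap.ker f)) : Module.Projective S M := by
  obtain ⟨P', _, _, f', hP', hf', hsup⟩ := hS M inferInstance inferInstance
  obtain ⟨g, hg⟩ := Module.projective_lifting_property f' f hf'
  have hgs : Function.Surjective g := by
    rw [← LinearMap.range_eq_top]
    apply hsup
    rw [eq_top_iff]
    intro x _
    obtain ⟨p, hp⟩ := hf (f' x)
    rw [← sub_add_cancel x (g p), add_comm]
    refine Submodule.add_mem_sup ⟨p, rfl⟩ ?_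
    have := LinearMap.congr_fun hg p
    simp only [LinearMap.comp_apply] at this
    simp [this, hp]
  obtain ⟨s, hs⟩ := Module.projective_lifting_property g LinearMap.id hgs
  have hs' : ∀ x, g (s x) = x := fun x => LinearMap.congr_fun hs x
  have hg' : ∀ x, f' (g x) = f x := fun x => LinearMap.congr_fun hg x
  let a : LinearMap.ker f' →ₗ[S] LinearMap.ker f :=
    s.restrict (fun x hx => by
      rw [LinearMap.mem_ker] at hx ⊢
      rw [← hg', hs', hx])
  let b : LinearMap.ker f →ₗ[S] LinearMap.ker f' :=
    g.restrict (fun x hx => by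
      rw [LinearMap.mem_ker] at hx ⊢
      rw [hg', hx])
  have hK' : Module.Projective S (LinearMap.ker f') :=
    Module.Projective.of_split a b (by ext x; exact hs' x)
  have hJ : ∀ x ∈ LinearMap.ker f', ∀ φ : Module.Dual S P', φ x ∈ (Ring.jacobson S : Ideal S) := by
    intro x hx φ
    rw [← Ideal.jacobson_bot, Ideal.jacobson, Ideal.mem_sInf]
    rintro m ⟨-, hm⟩
    by_contra hxm
    have htop : Submodule.comap φ m = ⊤ := by
      apply hsup
      rw [eq_top_iff]
      intro y _
      obtain ⟨c, i, hi, hc⟩ := hm.exists_inv hxm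
      have : y = (y - (φ y * c) • x) + (φ y * c) • x := by abel
      rw [this]
      refine Submodule.add_mem_sup ?_ (Submodule.smul_mem _ _ hx)
      rw [Submodule.mem_comap, map_sub, map_smul, smul_eq_mul]
      have : φ y - φ y * c * φ x = φ y * i := by linear_combination (φ y) * (-hc)
      rw [this]
      exact m.mul_mem_left _ hi
    have : x ∈ Submodule.comap φ m := htop ▸ trivial
    exact hxm this
  have hbot : ∀ x : LinearMap.ker f', x = 0 := by
    by_contra! hne
    obtain ⟨x₀, hx₀⟩ := hne
    obtain ⟨t, ⟨x, hx⟩, htJ⟩ := perfect_socle hS x₀ hx₀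
    obtain ⟨e, he⟩ := dualBasis_aux (S := S) (N := LinearMap.ker f')
    obtain ⟨e', he'⟩ := dualBasis_aux (S := S) (N := P')
    obtain ⟨u, hu⟩ := he x
    apply hx
    rw [hu, Finset.smul_sum]
    refine Finset.sum_eq_zero fun i _ => ?_
    apply Subtype.ext
    obtain ⟨v, hv⟩ := he' (i : P')
    rw [← smul_assoc, Submodule.coe_smul]
    conv_lhs => rw [hv]
    rw [Finset.smul_sum]
    refine Finset.sum_eq_zero fun k _ => ?_
    rw [← smul_assoc]
    have h1 : (t • e i x) • e' k (i : P') = 0 := by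
      have h2 := htJ _ (hJ i i.2 (e' k)) x
      have h3 := congrArg (e i) h2
      rw [map_smul, map_zero, smul_eq_mul] at h3
      rw [smul_eq_mul, smul_eq_mul]
      linear_combination h3
    rw [h1, zero_smul]
  have hinj : Function.Injective f' := by
    rw [← LinearMap.ker_eq_bot, eq_bot_iff]
    intro x hx
    have := hbot ⟨x, hx⟩
    exact congrArg Subtype.val this
  exact Module.Projective.of_equiv (LinearEquiv.ofBijective f' ⟨hinj, hf'⟩)

open TensorProduct in
theorem one_tmul_surj {R : Type u} [CommRing R] (I : Ideal R) (M : Type u) [AddCommGroup M]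
    [Module R M] (x : (R ⧸ I) ⊗[R] M) : ∃ m : M, x = 1 ⊗ₜ[R] m := by
  induction x with
  | zero => exact ⟨0, by simp⟩
  | tmul a m =>
    obtain ⟨a, rfl⟩ := Ideal.Quotient.mk_surjective a
    refine ⟨a • m, ?_⟩
    rw [TensorProduct.tmul_smul, TensorProduct.smul_tmul']
    congr 1
    rw [Algebra.smul_def, mul_one]; rfl
  | add x y hx hy =>
    obtain ⟨a, rfl⟩ := hx
    obtain ⟨b, rfl⟩ := hy
    exact ⟨a + b, by rw [TensorProduct.tmul_add]⟩

open TensorProduct in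
theorem one_tmul_eq_zero {R : Type u} [CommRing R] (r : R) (M : Type u) [AddCommGroup M]
    [Module R M] (m : M) :
    (1 ⊗ₜ[R] m : (R ⧸ Ideal.span {r}) ⊗[R] M) = 0 ↔ ∃ m' : M, m = r • m' := by
  constructor
  · intro h
    have h2 := congrArg (TensorProduct.quotTensorEquivQuotSMul M (Ideal.span {r})) h
    rw [map_zero] at h2
    have h3 : TensorProduct.quotTensorEquivQuotSMul M (Ideal.span {r})
        ((1 : R ⧸ Ideal.span {r}) ⊗ₜ[R] m) = Submodule.Quotient.mk m := by
      have := TensorProduct.quotTensorEquivQuotSMul_mk_tmul (Ideal.span {r}) (1 : R) m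
      simpa using this
    rw [h3, Submodule.Quotient.mk_eq_zero, Submodule.ideal_span_singleton_smul] at h2
    obtain ⟨m', -, hm'⟩ := h2
    exact ⟨m', hm'.symm⟩
  · rintro ⟨m', rfl⟩
    rw [TensorProduct.tmul_smul, TensorProduct.smul_tmul', Algebra.smul_def, mul_one]
    have : algebraMap R (R ⧸ Ideal.span {r}) r = 0 :=
      Ideal.Quotient.eq_zero_iff_mem.mpr (Ideal.mem_span_singleton_self r)
    rw [this, TensorProduct.zero_tmul]

open TensorProduct in
theorem baseChange_step {R : Type u} [CommRing R] (r : R) (hS : IsPerfectRing (R ⧸ Ideal.span {r}))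
    {P M : Type u} [AddCommGroup P] [Module R P] [AddCommGroup M] [Module R M]
    (f : P →ₗ[R] M) (hf : Function.Surjective f) (hM : ∀ m : M, r • m = 0 → m = 0)
    (hP : Module.Projective R P)
    (hK : Module.Projective (R ⧸ Ideal.span {r}) ((R ⧸ Ideal.span {r}) ⊗[R] LinearMap.ker f)) :
    Module.Projective (R ⧸ Ideal.span {r}) ((R ⧸ Ideal.span {r}) ⊗[R] M) := by
  let F := f.baseChange (R ⧸ Ideal.span {r})
  let G := (LinearMap.ker f).subtype.baseChange (R ⧸ Ideal.span {r})
  have hF : Function.Surjective F := by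
    intro y
    obtain ⟨m, rfl⟩ := one_tmul_surj _ _ y
    obtain ⟨p, rfl⟩ := hf m
    exact ⟨1 ⊗ₜ p, by simp [F]⟩
  have hFG : ∀ x, G x ∈ LinearMap.ker F := by
    intro x
    obtain ⟨k, rfl⟩ := one_tmul_surj _ _ x
    simp [F, G]
  have hb : Function.Bijective (G.codRestrict (LinearMap.ker F) hFG) := by
    constructor
    · refine (injective_iff_map_eq_zero (G.codRestrict (LinearMap.ker F) hFG)).mpr fun x hx => ?_
      obtain ⟨k, rfl⟩ := one_tmul_surj _ _ x
      have h0 : (1 ⊗ₜ[R] (k : P) : (R ⧸ Ideal.span {r}) ⊗[R] P) = 0 := by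
        have := congrArg Subtype.val hx
        simpa [G] using this
      obtain ⟨p, hp⟩ := (one_tmul_eq_zero r P _).mp h0
      have hp0 : f p = 0 := by
        apply hM
        rw [← map_smul, ← hp]
        exact k.2
      exact (one_tmul_eq_zero r _ _).mpr ⟨⟨p, hp0⟩, Subtype.ext hp⟩
    · rintro ⟨y, hy⟩
      obtain ⟨p, rfl⟩ := one_tmul_surj _ _ y
      have h0 : (1 ⊗ₜ[R] (f p) : (R ⧸ Ideal.span {r}) ⊗[R] M) = 0 := by
        simpa [F] using hy
      obtain ⟨m, hm⟩ := (one_tmul_eq_zero r M _).mp h0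
      obtain ⟨q, rfl⟩ := hf m
      refine ⟨1 ⊗ₜ ⟨p - r • q, by simp [hm]⟩, Subtype.ext ?_⟩
      simp only [LinearMap.codRestrict_apply, G, LinearMap.baseChange_tmul, Submodule.subtype_apply]
      rw [TensorProduct.tmul_sub, (one_tmul_eq_zero r P _).mpr ⟨q, rfl⟩, sub_zero]
  have : Module.Projective (R ⧸ Ideal.span {r}) (LinearMap.ker F) :=
    Module.Projective.of_equiv (LinearEquiv.ofBijective _ hb)
  exact perfect_pd_one hS F hF this

theorem projective_torsionFree {R : Type u} [CommRing R] [IsDomain R] {r : R} (hr : r ≠ 0)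
    {P : Type u} [AddCommGroup P] [Module R P] (hP : Module.Projective R P) (x : P)
    (hx : r • x = 0) : x = 0 := by
  obtain ⟨s, hs⟩ := dualBasis_aux (S := R) (N := P)
  obtain ⟨t, ht⟩ := hs x
  rw [ht]
  refine Finset.sum_eq_zero fun i _ => ?_
  have := congrArg (s i) hx
  rw [map_smul, map_zero, smul_eq_mul] at this
  rw [(mul_eq_zero.mp this).resolve_left hr, zero_smul]

open TensorProduct in
theorem baseChange_projective {R : Type u} [CommRing R] [IsDomain R] {r : R} (hr : r ≠ 0)
    (hS : IsPerfectRing (R ⧸ Ideal.span {r})) (n : ℕ) :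
    ∀ M : ModuleCat.{u} R, (∀ m : M, r • m = 0 → m = 0) → ProjDimLE R n M →
    Module.Projective (R ⧸ Ideal.span {r}) ((R ⧸ Ideal.span {r}) ⊗[R] M) := by
  induction n with
  | zero =>
    intro M _ h
    have h' : Projective M := h
    have : Module.Projective R M := (IsProjective.iff_projective M).mpr h'
    infer_instance
  | succ n ih =>
    rintro M hM ⟨P, f, hf, hP, hK⟩
    have hP' : Module.Projective R P := (IsProjective.iff_projective P).mpr hP
    let e : (kernel f : ModuleCat R) ≃ₗ[R] LinearMap.ker f.hom :=
      (ModuleCat.kernelIsoKer f).toLinearEquiv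
    have h1 := ih (kernel f) (by
      intro m hm
      have h2 : r • ((e m : LinearMap.ker f.hom) : P) = 0 := by
        rw [← Submodule.coe_smul, ← map_smul, hm, map_zero]; rfl
      have h3 := projective_torsionFree hr hP' _ h2
      exact e.injective (Subtype.ext (by simpa using h3))) hK
    refine baseChange_step r hS f.hom ((ModuleCat.epi_iff_surjective f).mp hf) hM hP' ?_
    exact Module.Projective.of_equiv (e.baseChange R (R ⧸ Ideal.span {r}) _ _)

open TensorProduct in
theorem local_principal {R : Type u} [CommRing R] [IsDomain R] (I : Ideal R) {r : R} (hr : r ≠ 0)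
    (hrI : r ∈ I) (hproj : Module.Projective (R ⧸ Ideal.span {r}) ((R ⧸ Ideal.span {r}) ⊗[R] I))
    (m : Ideal R) (hm : m.IsMaximal) :
    ∃ x ∈ I, ∃ d, d ∉ m ∧ ∀ y ∈ I, ∃ z, d * y = z * x := by
  have hmp : m.IsPrime := hm.isPrime
  by_cases hIm : I ≤ m
  swap
  · obtain ⟨d, hdI, hdm⟩ := SetLike.not_le_iff_exists.mp hIm
    exact ⟨d, hdI, d, hdm, fun y _ => ⟨y, mul_comm _ _⟩⟩
  let mk := Ideal.Quotient.mk (Ideal.span {r})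
  let mb : Ideal (R ⧸ Ideal.span {r}) := m.map mk
  have hspan : Ideal.span {r} ≤ m := (Ideal.span_singleton_le_iff_mem _).mpr (hIm hrI)
  have hmb : ∀ a, mk a ∈ mb ↔ a ∈ m := fun a => Ideal.mem_quotient_iff_mem hspan
  have hmks : Function.Surjective mk := Ideal.Quotient.mk_surjective
  have hmk0 : ∀ a, mk a = 0 → ∃ z, a = z * r := by
    intro a ha
    obtain ⟨z, hz⟩ := Ideal.mem_span_singleton'.mp (Ideal.Quotient.eq_zero_iff_mem.mp ha)
    exact ⟨z, hz.symm⟩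
  let ι : I →ₗ[R] (R ⧸ Ideal.span {r}) ⊗[R] I := TensorProduct.mk R (R ⧸ Ideal.span {r}) I 1
  have hιs : ∀ n, ∃ y, n = ι y := fun n => one_tmul_surj _ _ n
  have hι0 : ∀ y : I, ι y = 0 → ∃ b ∈ I, (y : R) = r * b := by
    intro y hy
    obtain ⟨b, hb⟩ := (one_tmul_eq_zero r I y).mp hy
    exact ⟨b, b.2, by rw [hb]; rfl⟩
  have hsm : ∀ (a : R) (n : (R ⧸ Ideal.span {r}) ⊗[R] I), mk a • n = a • n := fun a n =>
    algebraMap_smul (R ⧸ Ideal.span {r}) a n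
  have hrel : ∀ (f : Module.Dual (R ⧸ Ideal.span {r}) ((R ⧸ Ideal.span {r}) ⊗[R] I)) (a b : I),
      mk a * f (ι b) = mk b * f (ι a) := by
    intro f a b
    have h1 : mk a • ι b = mk b • ι a := by
      rw [hsm, hsm, ← map_smul, ← map_smul]
      congr 1
      exact Subtype.ext (mul_comm _ _)
    have h2 := congrArg f h1
    rwa [map_smul, map_smul, smul_eq_mul, smul_eq_mul] at h2
  have hone : ∀ c : R, mk c - 1 ∈ mb → c ∉ m := by
    intro c hc hcm
    rw [← map_one mk, ← map_sub, hmb] at hc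
    apply hmp.ne_top
    rw [Ideal.eq_top_iff_one]
    have := m.sub_mem hcm hc
    simpa using this
  obtain ⟨f, n, hfn⟩ : ∃ (f : Module.Dual (R ⧸ Ideal.span {r}) ((R ⧸ Ideal.span {r}) ⊗[R] I)) (n : _),
      f n ∉ mb := by
    by_contra! hcon
    obtain ⟨c, hc, hc0⟩ := proj_nak mb LinearMap.id hcon (ι ⟨r, hrI⟩) 1 1 (by simp) (by simp)
    obtain ⟨c, rfl⟩ := hmks c
    rw [hsm, ← map_smul] at hc0
    obtain ⟨b, hb, hcb⟩ := hι0 _ hc0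
    have hcb' : c * r = r * b := hcb
    have : c = b := mul_right_cancel₀ hr (by rw [hcb', mul_comm])
    exact hone c hc (hIm (this ▸ hb))
  obtain ⟨x, rfl⟩ := hιs n
  obtain ⟨d, hd⟩ := hmks (f (ι x))
  have hdm : d ∉ m := by
    rw [← hd, hmb] at hfn
    exact hfn
  have hY : ∀ y : I, ∃ c z, d * y = c * x + z * r := by
    intro y
    obtain ⟨c, hc⟩ := hmks (f (ι y))
    obtain ⟨z, hz⟩ := hmk0 (d * y - c * x) (by
      have := hrel f x y
      rw [map_sub, map_mul, map_mul, hd, hc]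
      linear_combination -this)
    exact ⟨c, z, by linear_combination hz⟩
  obtain ⟨d', i, hi, hd'⟩ := hm.exists_inv hdm
  let φ : (R ⧸ Ideal.span {r}) ⊗[R] I →ₗ[R ⧸ Ideal.span {r}] (R ⧸ Ideal.span {r}) ⊗[R] I :=
    mk d • LinearMap.id - f.smulRight (ι x)
  have hφ : ∀ n, φ n = mk d • n - f n • ι x := fun n => rfl
  have hfφ : ∀ n, f (φ n) = 0 := by
    intro n
    rw [hφ, map_sub, map_smul, map_smul, ← hd, smul_eq_mul, smul_eq_mul]
    ring
  by_cases hcase : ∃ (g : Module.Dual (R ⧸ Ideal.span {r}) ((R ⧸ Ideal.span {r}) ⊗[R] I)) (n : _),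
      g (φ n) ∉ mb
  · obtain ⟨g, n', hg⟩ := hcase
    have hfv := hfφ n'
    obtain ⟨y', hy'⟩ := hιs (φ n')
    rw [hy'] at hg hfv
    obtain ⟨w, hw⟩ := hmks (g (ι y'))
    have hwm : w ∉ m := by
      rw [← hw, hmb] at hg
      exact hg
    obtain ⟨z0, hz0⟩ := hmk0 (d * w * x) (by
      have h1 := hrel f x y'
      have h2 := hrel g x y'
      rw [hfv, ← hd] at h1
      rw [← hw] at h2
      rw [map_mul, map_mul]
      linear_combination mk d * h2 - g (ι x) * h1)
    refine ⟨r, hrI, d * w * d, hmp.mul_notMem (hmp.mul_notMem hdm hwm) hdm, fun y hy => ?_⟩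
    obtain ⟨c, z, hcz⟩ := hY ⟨y, hy⟩
    refine ⟨c * z0 + w * d * z, ?_⟩
    simp only at hcz
    linear_combination d * w * hcz + c * hz0
  · push Not at hcase
    obtain ⟨c, hc, hc0⟩ := proj_nak mb φ hcase (φ (ι ⟨r, hrI⟩)) (mk d) (mk d')
      (by rw [hφ (φ _), hfφ, zero_smul, sub_zero])
      (by
        rw [← map_mul, ← map_one mk, ← map_sub, hmb]
        have : 1 - d' * d = i := by linear_combination -hd'
        rwa [this])
    obtain ⟨c, rfl⟩ := hmks c
    obtain ⟨k, hk⟩ := hmks (f (ι ⟨r, hrI⟩))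
    rw [hφ, ← hk, hsm, hsm, hsm, ← map_smul, ← map_smul, ← map_sub, ← map_smul] at hc0
    obtain ⟨b, hb, hcb⟩ := hι0 _ hc0
    have hcb' : c * (d * r - k * x) = r * b := hcb
    have hcm := hone c hc
    refine ⟨x, x.2, (c * d - b) * d, hmp.mul_notMem ?_ hdm, fun y hy => ?_⟩
    · intro h
      have := m.add_mem h (hIm hb)
      rw [sub_add_cancel] at this
      exact hmp.mul_notMem hcm hdm this
    · obtain ⟨a, z, haz⟩ := hY ⟨y, hy⟩
      simp only at haz
      refine ⟨(c * d - b) * a + z * c * k, ?_⟩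
      linear_combination (c * d - b) * haz + z * hcb'

open scoped nonZeroDivisors in
theorem dedekind_of_local {R : Type u} [CommRing R] [IsDomain R]
    (h : ∀ I : Ideal R, I ≠ ⊥ → ∀ m : Ideal R, m.IsMaximal →
      ∃ x ∈ I, ∃ d, d ∉ m ∧ ∀ y ∈ I, ∃ z, d * y = z * x) : IsDedekindDomain R := by
  rw [isDedekindDomain_iff_mul_inv_cancel (K := FractionRing R)]
  have key : ∀ I : Ideal R, I ≠ ⊥ →
      (I : FractionalIdeal R⁰ (FractionRing R)) * (I : FractionalIdeal R⁰ (FractionRing R))⁻¹ = 1 := by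
    intro I hI
    have hI0 : (I : FractionalIdeal R⁰ (FractionRing R)) ≠ 0 := by
      simpa using hI
    obtain ⟨J, hJ⟩ := FractionalIdeal.le_one_iff_exists_coeIdeal.mp
      (show (I : FractionalIdeal R⁰ (FractionRing R)) *
        (I : FractionalIdeal R⁰ (FractionRing R))⁻¹ ≤ 1 by
          rw [FractionalIdeal.inv_eq]; exact FractionalIdeal.mul_one_div_le_one)
    rw [← hJ]
    by_contra hne
    have hJt : J ≠ ⊤ := by
      rintro rfl
      exact hne (FractionalIdeal.coeIdeal_top _)
    obtain ⟨m, hm, hJm⟩ := Ideal.exists_le_maximal J hJt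
    obtain ⟨x, hxI, d, hdm, hd⟩ := h I hI m hm
    obtain ⟨y, hyI, hy0⟩ := Submodule.exists_mem_ne_zero_of_ne_bot hI
    have hd0 : d ≠ 0 := fun h0 => hdm (h0 ▸ m.zero_mem)
    have hx0 : x ≠ 0 := by
      rintro rfl
      obtain ⟨z, hz⟩ := hd y hyI
      rw [mul_zero] at hz
      exact (mul_ne_zero hd0 hy0) hz
    have hx0' : algebraMap R (FractionRing R) x ≠ 0 := by simpa using hx0
    apply hdm
    apply hJm
    have hmem : algebraMap R (FractionRing R) d ∈ (J : FractionalIdeal R⁰ (FractionRing R)) := by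
      rw [hJ]
      have h1 : algebraMap R (FractionRing R) d = algebraMap R (FractionRing R) x *
          (algebraMap R (FractionRing R) d / algebraMap R (FractionRing R) x) := by
        field_simp
      rw [h1]
      refine FractionalIdeal.mul_mem_mul (FractionalIdeal.mem_coeIdeal_of_mem _ hxI) ?_
      rw [FractionalIdeal.mem_inv_iff hI0]
      intro y hy
      obtain ⟨y, hy', rfl⟩ := (FractionalIdeal.mem_coeIdeal _).mp hy
      obtain ⟨z, hz⟩ := hd y hy'
      rw [FractionalIdeal.mem_one_iff]
      refine ⟨z, ?_⟩
      have := congrArg (algebraMap R (FractionRing R)) hz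
      rw [map_mul, map_mul] at this
      field_simp
      linear_combination -this
    obtain ⟨d1, hd1, hd2⟩ := (FractionalIdeal.mem_coeIdeal _).mp hmem
    exact (IsFractionRing.injective R (FractionRing R) hd2) ▸ hd1
  intro I hI
  obtain ⟨a, J, ha, rfl⟩ := FractionalIdeal.exists_eq_spanSingleton_mul I
  have ha' : algebraMap R (FractionRing R) a ≠ 0 := by simpa using ha
  have hJ : J ≠ ⊥ := by
    rintro rfl
    apply hI
    simp
  rw [FractionalIdeal.mul_inv_cancel_iff]
  refine ⟨FractionalIdeal.spanSingleton R⁰ (algebraMap R (FractionRing R) a) *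
    (J : FractionalIdeal R⁰ (FractionRing R))⁻¹, ?_⟩
  rw [mul_mul_mul_comm, key J hJ, FractionalIdeal.spanSingleton_mul_spanSingleton,
    inv_mul_cancel₀ ha', FractionalIdeal.spanSingleton_one, mul_one]

theorem dedekind_of_APD {R : Type u} [CommRing R] [IsDomain R] (h : IsAPD R) (n : ℕ)
    (hn : ∀ M : ModuleCat.{u} R, ProjDimLE R n M) : IsDedekindDomain R := by
  refine dedekind_of_local fun I hI m hm => ?_
  obtain ⟨r, hrI, hr⟩ := Submodule.exists_mem_ne_zero_of_ne_bot hI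
  have hS := h (Ideal.span {r}) (by simpa using hr)
  refine local_principal I hr hrI ?_ m hm
  refine baseChange_projective hr hS n (ModuleCat.of R I) ?_ (hn _)
  rintro ⟨x, hx⟩ hx0
  have : r * x = 0 := congrArg Subtype.val hx0
  exact Subtype.ext ((mul_eq_zero.mp this).resolve_left hr)

theorem dedekind_ideal_projective {R : Type u} [CommRing R] [IsDedekindDomain R] (I : Ideal R) :
    Module.Projective R I := by
  have hflat : Module.Flat R I := by
    rw [IsDedekindDomain.flat_iff_torsion_eq_bot, eq_bot_iff]
    rintro ⟨x, hx⟩ ⟨⟨a, ha⟩, hax⟩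
    have h1 : a * x = 0 := congrArg Subtype.val hax
    have h2 : x = 0 := (mul_eq_zero.mp h1).resolve_left (nonZeroDivisors.ne_zero ha)
    exact Subtype.ext h2
  have : Module.FinitePresentation R I := Module.finitePresentation_of_finite R I
  exact Module.Flat.projective_of_finitePresentation

theorem hereditary_quot_injective {R : Type u} [CommRing R]
    (hR : ∀ I : Ideal R, Module.Projective R I) (E Q : Type u) [AddCommGroup E] [Module R E]
    [AddCommGroup Q] [Module R Q] (hE : Module.Injective R E) (q : E →ₗ[R] Q)
    (hq : Function.Surjective q) : Module.Injective R Q := by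
  apply Module.Baer.injective
  intro I g
  have := hR I
  obtain ⟨g1, hg1⟩ := Module.projective_lifting_property q g hq
  obtain ⟨g2, hg2⟩ := (Module.Baer.of_injective hE) I g1
  refine ⟨q ∘ₗ g2, fun x hx => ?_⟩
  rw [LinearMap.comp_apply, hg2 x hx]
  exact LinearMap.congr_fun hg1 ⟨x, hx⟩

theorem exists_injective_embedding {R : Type u} [CommRing R] (A : Type u) [AddCommGroup A]
    [Module R A] : ∃ (E : Type u) (_ : AddCommGroup E) (_ : Module R E) (j : A →ₗ[R] E),
      Module.Injective R E ∧ Function.Injective j := by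
  obtain ⟨⟨J, hJ, f, hf⟩⟩ := EnoughInjectives.presentation (ModuleCat.of R A)
  refine ⟨J, inferInstance, inferInstance, f.hom, ?_, ?_⟩
  · exact Module.injective_module_of_injective_object R J
  · exact (ModuleCat.mono_iff_injective f).mp hf

theorem hereditary_submodule {R : Type u} [CommRing R]
    (hR : ∀ I : Ideal R, Module.Projective R I) (P : Type u) [AddCommGroup P] [Module R P]
    [Module.Projective R P] (K : Submodule R P) : Module.Projective R K := by
  apply Module.Projective.of_lifting_property
  intro A B _ _ _ _ f g hf
  obtain ⟨E, _, _, j, hE, hj⟩ := exists_injective_embedding (R := R) A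
  let C := Submodule.map j (LinearMap.ker f)
  have hQ : Module.Injective R (E ⧸ C) :=
    hereditary_quot_injective hR E (E ⧸ C) hE C.mkQ C.mkQ_surjective
  let β : B →ₗ[R] E ⧸ C := ((LinearMap.ker f).liftQ (C.mkQ ∘ₗ j) (by
    intro x hx
    exact (Submodule.Quotient.mk_eq_zero C).mpr ⟨x, hx, rfl⟩)) ∘ₗ
      (f.quotKerEquivOfSurjective hf).symm.toLinearMap
  have hβ : ∀ a, β (f a) = C.mkQ (j a) := by
    intro a
    have : (f.quotKerEquivOfSurjective hf).symm (f a) = Submodule.Quotient.mk a := by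
      rw [LinearEquiv.symm_apply_eq]; rfl
    simp only [β, LinearMap.comp_apply, LinearEquiv.coe_coe, this]
    rfl
  have hβi : ∀ a a', C.mkQ (j a) = β (f a') → f a = f a' := by
    intro a a' h
    rw [hβ, ← sub_eq_zero, ← map_sub, ← map_sub] at h
    obtain ⟨y, hy, hy'⟩ := (Submodule.Quotient.mk_eq_zero C).mp h
    have := hj hy'
    rw [← sub_eq_zero, ← map_sub, ← this]
    exact hy
  obtain ⟨G, hG⟩ := hQ.out K.subtype K.injective_subtype (β ∘ₗ g)
  obtain ⟨G', hG'⟩ := Module.projective_lifting_property C.mkQ G C.mkQ_surjective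
  have hGG : ∀ k : K, C.mkQ (G' k) = β (g k) := by
    intro k
    have h1 := LinearMap.congr_fun hG' (k : P)
    have h2 := hG k
    simp only [LinearMap.comp_apply] at h1 h2
    rw [h1]; exact h2
  have hr : ∀ k : K, (G' ∘ₗ K.subtype) k ∈ LinearMap.range j := by
    intro k
    obtain ⟨a, ha⟩ := hf (g k)
    have h1 := hGG k
    rw [← ha, hβ, ← sub_eq_zero, ← map_sub] at h1
    obtain ⟨y, hy, hy'⟩ := (Submodule.Quotient.mk_eq_zero C).mp h1
    exact ⟨y + a, by rw [map_add, hy']; simp⟩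
  let h : K →ₗ[R] A := (LinearEquiv.ofInjective j hj).symm.toLinearMap ∘ₗ
    (G' ∘ₗ K.subtype).codRestrict (LinearMap.range j) hr
  have hh : ∀ k, j (h k) = G' k := by
    intro k
    have := LinearEquiv.apply_symm_apply (LinearEquiv.ofInjective j hj)
      ((G' ∘ₗ K.subtype).codRestrict (LinearMap.range j) hr k)
    exact congrArg Subtype.val this
  refine ⟨h, LinearMap.ext fun k => ?_⟩
  obtain ⟨a, ha⟩ := hf (g k)
  rw [LinearMap.comp_apply, ← ha]
  apply hβi
  rw [hh, hGG, ha]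

theorem dedekind_projDim {R : Type u} [CommRing R] [IsDedekindDomain R] (M : ModuleCat.{u} R) :
    ProjDimLE R 1 M := by
  let f : ModuleCat.of R (M →₀ R) ⟶ M := ModuleCat.ofHom (Finsupp.linearCombination R id)
  have hf : Function.Surjective f.hom := Finsupp.linearCombination_id_surjective R M
  refine ⟨ModuleCat.of R (M →₀ R), f, (ModuleCat.epi_iff_surjective f).mpr hf,
    (IsProjective.iff_projective _).mp inferInstance, ?_⟩
  change Projective (kernel f)
  have hK : Module.Projective R (LinearMap.ker f.hom) :=
    hereditary_submodule dedekind_ideal_projective _ _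
  let e : (kernel f : ModuleCat R) ≃ₗ[R] LinearMap.ker f.hom :=
      (ModuleCat.kernelIsoKer f).toLinearEquiv
  have : Module.Projective R (kernel f : ModuleCat R) := Module.Projective.of_equiv e.symm
  exact (IsProjective.iff_projective _).mp this

theorem artinian_idem {S : Type u} [CommRing S] [IsArtinianRing S] (m : Ideal S)
    (hm : m.IsMaximal) : ∃ e : S, e * e = e ∧ 1 - e ∈ m ∧
      ∀ m' : Ideal S, m'.IsMaximal → m' ≠ m → e ∈ m' := by
  classical
  obtain ⟨k, hk⟩ := (IsSemiprimaryRing.isNilpotent : IsNilpotent (Ring.jacobson S))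
  have := Fintype.ofFinite (MaximalSpectrum S)
  let B : Ideal S := ∏ n ∈ Finset.univ.erase (⟨m, hm⟩ : MaximalSpectrum S), n.asIdeal
  have hBle : ∀ m' : Ideal S, m'.IsMaximal → m' ≠ m → B ≤ m' := by
    intro m' hm' hne
    exact Ideal.prod_le_inf.trans (Finset.inf_le (f := fun n : MaximalSpectrum S => n.asIdeal)
      (b := ⟨m', hm'⟩) (by simp [hne]))
  have hcop : IsCoprime m B := by
    refine IsCoprime.prod_right fun n hn => ?_
    rw [Ideal.isCoprime_iff_sup_eq]
    refine Ideal.IsMaximal.coprime_of_ne hm n.isMaximal ?_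
    rintro rfl
    simp at hn
  have hcop' : IsCoprime (m ^ (k + 1)) (B ^ (k + 1)) := hcop.pow
  obtain ⟨a, ha, b, hb, hab⟩ := Ideal.isCoprime_iff_exists.mp hcop'
  have hmul : a * b = 0 := by
    have h1 : a * b ∈ (m * B) ^ (k + 1) := by
      rw [mul_pow]; exact Ideal.mul_mem_mul ha hb
    have h2 : m * B ≤ Ring.jacobson S := by
      rw [← Ideal.jacobson_bot, Ideal.jacobson]
      refine le_sInf ?_
      rintro m' ⟨-, hm'⟩
      by_cases h : m' = m
      · rw [h]
        exact Ideal.mul_le.mpr fun a ha b _ => m.mul_mem_right b ha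
      · exact Ideal.mul_le.mpr fun a _ b hb => m'.mul_mem_left a (hBle m' hm' h hb)
    have h3 := Ideal.pow_right_mono h2 (k + 1) h1
    rw [pow_succ, hk, zero_mul] at h3
    exact h3
  refine ⟨b, by linear_combination -hmul + b * hab, ?_, fun m' hm' hne => ?_⟩
  · have : 1 - b = a := by linear_combination -hab
    rw [this]
    exact Ideal.pow_le_self (Nat.succ_ne_zero k) ha
  · exact hBle m' hm' hne (Ideal.pow_le_self (Nat.succ_ne_zero k) hb)

theorem artinian_simple_cover {S : Type u} [CommRing S] [IsArtinianRing S] (W : Type u)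
    [AddCommGroup W] [Module S W] [IsSimpleModule S W] :
    ∃ (P : Type u) (_ : AddCommGroup P) (_ : Module S P) (f : P →ₗ[S] W),
      Module.Projective S P ∧ Function.Surjective f ∧
      LinearMap.ker f ≤ (Ring.jacobson S : Ideal S) • ⊤ := by
  have := IsSimpleModule.nontrivial S W
  obtain ⟨w, hw⟩ := exists_ne (0 : W)
  obtain ⟨e, hee, he1, he⟩ := artinian_idem _ (IsSimpleModule.ker_toSpanSingleton_isMaximal S hw)
  let I : Ideal S := Ideal.span {e}
  have hIe : ∀ x ∈ I, x * e = x := by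
    intro x hx
    obtain ⟨y, rfl⟩ := Ideal.mem_span_singleton'.mp hx
    rw [mul_assoc, hee]
  have heI : e ∈ I := Ideal.mem_span_singleton_self e
  have hew : e • w = w := by
    have : (1 - e) • w = 0 := he1
    rw [sub_smul, one_smul, sub_eq_zero] at this
    exact this.symm
  refine ⟨I, inferInstance, inferInstance, LinearMap.toSpanSingleton S W w ∘ₗ I.subtype, ?_, ?_, ?_⟩
  · refine Module.Projective.of_split (M := S) I.subtype
      (LinearMap.toSpanSingleton S I ⟨e, heI⟩) ?_
    ext x
    exact hIe x x.2
  · intro v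
    obtain ⟨a, ha⟩ := IsSimpleModule.toSpanSingleton_surjective S hw v
    refine ⟨⟨a * e, I.mul_mem_left _ heI⟩, ?_⟩
    change (a * e) • w = v
    rw [mul_smul, hew]
    exact ha
  · rintro ⟨x, hx⟩ hxw
    have hxm : x ∈ LinearMap.ker (LinearMap.toSpanSingleton S W w) := hxw
    have hxJ : x ∈ (Ring.jacobson S : Ideal S) := by
      rw [← Ideal.jacobson_bot, Ideal.jacobson, Ideal.mem_sInf]
      rintro m' ⟨-, hm'⟩
      by_cases h : m' = LinearMap.ker (LinearMap.toSpanSingleton S W w)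
      · rw [h]; exact hxm
      · rw [← hIe x hx]
        exact m'.mul_mem_left _ (he m' hm' h)
    have : (⟨x, hx⟩ : I) = x • ⟨e, heI⟩ := Subtype.ext (hIe x hx).symm
    rw [this]
    exact Submodule.smul_mem_smul hxJ trivial

theorem nilp_nak {S : Type u} [CommRing S] (J : Ideal S) (hJ : IsNilpotent J) {P : Type u}
    [AddCommGroup P] [Module S P] (N : Submodule S P) (h : N ⊔ J • (⊤ : Submodule S P) = ⊤) : N = ⊤ := by
  obtain ⟨k, hk⟩ := hJ
  have key : ∀ n : ℕ, N ⊔ (J ^ n : Ideal S) • (⊤ : Submodule S P) = ⊤ := by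
    intro n
    induction n with
    | zero => simp
    | succ n ih =>
      have h1 : (J ^ n : Ideal S) • (⊤ : Submodule S P) =
          (J ^ n : Ideal S) • N ⊔ (J ^ n : Ideal S) • (J • (⊤ : Submodule S P)) := by
        rw [← Submodule.smul_sup, h]
      refine top_unique (ih.symm.le.trans (sup_le le_sup_left ?_))
      rw [h1]
      refine sup_le (le_trans Submodule.smul_le_right le_sup_left) ?_
      rw [pow_succ, Submodule.mul_smul]
      exact le_sup_right
  have h2 := key k
  rw [hk] at h2
  simpa using h2

theorem artinian_perfect {S : Type u} [CommRing S] [IsArtinianRing S] : IsPerfectRing S := by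
  classical
  intro M _ _
  have hnil := (IsSemiprimaryRing.isNilpotent : IsNilpotent (Ring.jacobson S))
  let J : Ideal S := Ring.jacobson S
  let V := M ⧸ (J • ⊤ : Submodule S M)
  have hV : IsSemisimpleModule S V := by
    have h : Module.IsTorsionBySet S V (J : Set S) := by
      rintro x ⟨a, ha⟩
      obtain ⟨x, rfl⟩ := Submodule.Quotient.mk_surjective _ x
      exact (Submodule.Quotient.mk_eq_zero _).mpr (Submodule.smul_mem_smul ha trivial)
    let := h.module
    have hss : IsSemisimpleRing (S ⧸ J) := IsSemiprimaryRing.isSemisimpleRing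
    exact (h.semilinearMap.isSemisimpleModule_iff_of_bijective Function.bijective_id).2
      inferInstance
  obtain ⟨s, e, -, hs⟩ := IsSemisimpleModule.exists_linearEquiv_dfinsupp S V
  have hcov := fun i : s => artinian_simple_cover (S := S) i.1
  choose P i1 i2 f hP hf hker using hcov
  let F : (Π₀ i, P i) →ₗ[S] (Π₀ i : s, i.1) := DFinsupp.mapRange.linearMap f
  have hF : Function.Surjective F := (DFinsupp.mapRange_surjective _ (fun i => map_zero _)).mpr hf
  have hFk : LinearMap.ker F ≤ J • ⊤ := by
    intro x hx
    rw [← DFinsupp.sum_single (f := x)]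
    refine Submodule.sum_mem _ fun i _ => ?_
    have hxi : f i (x i) = 0 := by
      have := DFunLike.congr_fun (LinearMap.mem_ker.mp hx) i
      simpa [F] using this
    have h1 := Submodule.mem_map_of_mem (f := DFinsupp.lsingle (R := S) i) (hker i hxi)
    rw [Submodule.map_smul''] at h1
    exact Submodule.smul_mono le_rfl le_top h1
  let q : (Π₀ i, P i) →ₗ[S] V := e.symm.toLinearMap ∘ₗ F
  obtain ⟨g, hg⟩ := Module.projective_lifting_property (Submodule.mkQ (J • ⊤ : Submodule S M)) q
    (Submodule.mkQ_surjective _)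
  have hgq : ∀ x, Submodule.mkQ (J • ⊤ : Submodule S M) (g x) = q x :=
    fun x => LinearMap.congr_fun hg x
  refine ⟨Π₀ i, P i, inferInstance, inferInstance, g, inferInstance, ?_, ?_⟩
  · rw [← LinearMap.range_eq_top]
    apply nilp_nak J hnil
    rw [eq_top_iff]
    intro y _
    obtain ⟨x, hx⟩ := hF (e (Submodule.mkQ (J • ⊤ : Submodule S M) y))
    have hqx : q x = Submodule.mkQ (J • ⊤ : Submodule S M) y := by
      simp only [q, LinearMap.comp_apply, hx, LinearEquiv.coe_coe, LinearEquiv.symm_apply_apply]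
    rw [← hgq] at hqx
    rw [← sub_add_cancel y (g x), add_comm]
    refine Submodule.add_mem_sup ⟨x, rfl⟩ ?_
    rw [← Submodule.Quotient.mk_eq_zero]
    change Submodule.mkQ (J • ⊤ : Submodule S M) (y - g x) = 0
    rw [map_sub, hqx, sub_self]
  · intro N hN
    apply nilp_nak J hnil
    refine top_unique (hN.symm.le.trans (sup_le_sup_left ?_ _))
    refine le_trans ?_ hFk
    intro x hx
    have h1 := hgq x
    rw [LinearMap.mem_ker.mp hx, map_zero] at h1
    have h2 : e.symm (F x) = 0 := h1.symm
    simpa using h2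

theorem dedekind_APD {R : Type u} [CommRing R] [IsDomain R] [IsDedekindDomain R] : IsAPD R := by
  intro I hI
  have : Ring.KrullDimLE 0 (R ⧸ I) := by
    refine Ring.KrullDimLE.mk₀ fun J hJ => ?_
    have hp : (J.comap (Ideal.Quotient.mk I)).IsPrime := Ideal.comap_isPrime _ _
    have hle : I ≤ J.comap (Ideal.Quotient.mk I) := by
      intro x hx
      rw [Ideal.mem_comap, Ideal.Quotient.eq_zero_iff_mem.mpr hx]
      exact J.zero_mem
    have hmax : (J.comap (Ideal.Quotient.mk I)).IsMaximal :=
      hp.isMaximal (fun h => hI (le_bot_iff.mp (h ▸ hle)))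
    have hs : Function.Surjective (Ideal.Quotient.mk I) := Ideal.Quotient.mk_surjective
    rw [← Ideal.map_comap_of_surjective _ hs J]
    refine (Ideal.map_eq_top_or_isMaximal_of_surjective _ hs hmax).resolve_left fun h => ?_
    rw [Ideal.map_comap_of_surjective _ hs J] at h
    exact hJ.ne_top h
  have : IsArtinianRing (R ⧸ I) := IsNoetherianRing.isArtinianRing_of_krullDimLE_zero
  exact artinian_perfect
/-- An integral domain is Dedekind iff it is an almost perfect domain of finite global
dimension, iff it is an almost perfect domain of global dimension at most one. -/
theorem dedekind_iff_APD_finite_global_dimension (R : Type u) [CommRing R] [IsDomain R] :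
    (IsDedekindDomain R ↔
      (IsAPD R ∧ ∃ n : ℕ, ∀ M : ModuleCat.{u} R, ProjDimLE R n M)) ∧
    (IsDedekindDomain R ↔
      (IsAPD R ∧ ∀ M : ModuleCat.{u} R, ProjDimLE R 1 M)) := by
  refine ⟨⟨fun _ => ⟨dedekind_APD, 1, dedekind_projDim⟩, fun ⟨h, n, hn⟩ => dedekind_of_APD h n hn⟩,
    ⟨fun _ => ⟨dedekind_APD, dedekind_projDim⟩, fun ⟨h, hn⟩ => dedekind_of_APD h 1 hn⟩⟩
end
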